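/- arXiv:2009.02140 — 6 statements merged into one kernel-verified Lean document; each statement's English description precedes it below -/
import Mathlib

section
/- Let d ≥ 1 and let A be a finite nonempty subset of ℤ^d. Then there exist a polynomial p ∈ ℚ[x] of degree at most d and a natural number H such that |hA| = p(h) for every natural number h ≥ H. -/
open Pointwise

/-- The `h`-fold sumset `hA` of a set `A` in an additive commutative monoid:
`0A = {0}` and `(n+1)A = A + nA`. -/
def iterSumset {G : Type*} [AddCommMonoid G] (A : Set G) : ℕ → Set G
  | 0 => {0}
  | n + 1 => A + iterSumset A n

/-- Eventually polynomial functions. -/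
def EvPoly (f : ℕ → ℚ) : Prop :=
  ∃ (p : Polynomial ℚ) (H : ℕ), ∀ h : ℕ, H ≤ h → f h = p.eval (h : ℚ)

theorem EvPoly.congr {f g : ℕ → ℚ} (hf : EvPoly f) (N : ℕ) (h : ∀ n, N ≤ n → g n = f n) :
    EvPoly g := by
  obtain ⟨p, H, hp⟩ := hf
  refine ⟨p, max H N, fun n hn => ?_⟩
  rw [h n (le_trans (le_max_right _ _) hn), hp n (le_trans (le_max_left _ _) hn)]

theorem EvPoly.const (c : ℚ) : EvPoly (fun _ => c) := ⟨Polynomial.C c, 0, by simp⟩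

theorem EvPoly.add {f g : ℕ → ℚ} (hf : EvPoly f) (hg : EvPoly g) :
    EvPoly (fun n => f n + g n) := by
  obtain ⟨p, H, hp⟩ := hf
  obtain ⟨q, K, hq⟩ := hg
  refine ⟨p + q, max H K, fun n hn => ?_⟩
  beta_reduce
  rw [hp n (le_trans (le_max_left _ _) hn), hq n (le_trans (le_max_right _ _) hn),
    Polynomial.eval_add]

theorem EvPoly.sum {f : ℕ → ℕ → ℚ} (N : ℕ) (hf : ∀ i, EvPoly (f i)) :
    EvPoly (fun n => ∑ i ∈ Finset.range N, f i n) := by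
  induction N with
  | zero => simpa using EvPoly.const 0
  | succ N ih =>
    simp only [Finset.sum_range_succ]
    exact ih.add (hf N)

theorem EvPoly.shift {f : ℕ → ℚ} (hf : EvPoly f) (k : ℕ) : EvPoly (fun n => f (n - k)) := by
  obtain ⟨p, H, hp⟩ := hf
  refine ⟨p.comp (Polynomial.X - Polynomial.C (k : ℚ)), H + k, fun n hn => ?_⟩
  beta_reduce
  rw [hp _ (by omega), Polynomial.eval_comp]
  simp [Nat.cast_sub (show k ≤ n by omega)]

theorem EvPoly.polySum (p : Polynomial ℚ) :
    ∃ q : Polynomial ℚ, ∀ n : ℕ, ∑ m ∈ Finset.range n, p.eval (m : ℚ) = q.eval (n : ℚ) := by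
  induction p using Polynomial.induction_on' with
  | add p q hp hq =>
    obtain ⟨p', hp⟩ := hp
    obtain ⟨q', hq⟩ := hq
    exact ⟨p' + q', fun n => by simp [Finset.sum_add_distrib, hp, hq]⟩
  | monomial j c =>
    refine ⟨Polynomial.C c * ∑ i ∈ Finset.range (j + 1),
      Polynomial.C (bernoulli i * ((j + 1).choose i) / (j + 1)) *
        Polynomial.X ^ (j + 1 - i), fun n => ?_⟩
    simp only [Polynomial.eval_monomial, ← Finset.mul_sum, sum_range_pow, Polynomial.eval_mul,
      Polynomial.eval_C, Polynomial.eval_finsetSum, Polynomial.eval_pow, Polynomial.eval_X]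
    congr 1
    refine Finset.sum_congr rfl fun i _ => ?_
    ring

theorem EvPoly.partialSum {f : ℕ → ℚ} (hf : EvPoly f) :
    EvPoly (fun n => ∑ m ∈ Finset.range (n + 1), f m) := by
  obtain ⟨p, H, hp⟩ := hf
  obtain ⟨q, hq⟩ := EvPoly.polySum p
  refine ⟨q.comp (Polynomial.X + 1) +
    Polynomial.C (∑ m ∈ Finset.range H, (f m - p.eval (m : ℚ))), H, fun n hn => ?_⟩
  have h1 : ∑ m ∈ Finset.range (n + 1), (f m - p.eval (m : ℚ)) =
      ∑ m ∈ Finset.range H, (f m - p.eval (m : ℚ)) := by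
    symm
    apply Finset.sum_subset
    · intro x hx
      simp at *
      omega
    · intro x _ hx
      rw [hp x (by simpa using hx), sub_self]
  rw [Polynomial.eval_add, Polynomial.eval_C, ← h1, Polynomial.eval_comp]
  have := hq (n + 1)
  push_cast at this
  simp [Finset.sum_sub_distrib, ← this]

open Classical in
/-- number of points of height `h` outside `U`. -/
noncomputable def cnt (k : ℕ) (U : Set (Fin k → ℕ)) (h : ℕ) : ℕ :=
  ((Finset.Nat.antidiagonalTuple k h).filter (fun x => x ∉ U)).card

theorem cnt_succ (k : ℕ) (U : Set (Fin (k + 1) → ℕ)) (h : ℕ) :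
    cnt (k + 1) U h = ∑ n ∈ Finset.range (h + 1), cnt k {x | Fin.cons n x ∈ U} (h - n) := by
  classical
  unfold cnt
  rw [Finset.card_eq_sum_card_fiberwise (f := fun x => x 0) (t := Finset.range (h + 1))]
  · refine Finset.sum_congr rfl fun n hn => ?_
    symm
    apply Finset.card_bij (fun x _ => (Fin.cons n x : Fin (k + 1) → ℕ))
    · intro x hx
      simp [Finset.Nat.mem_antidiagonalTuple, Fin.sum_univ_succ] at *
      refine ⟨by omega, hx.2⟩
    · intro x _ y _ hxy
      exact (Fin.cons_inj.1 hxy).2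
    · intro x hx
      simp only [Finset.mem_filter, Finset.Nat.mem_antidiagonalTuple, Fin.sum_univ_succ] at hx
      obtain ⟨⟨h1, h2⟩, h3⟩ := hx
      subst h3
      refine ⟨Fin.tail x, ?_, Fin.cons_self_tail x⟩
      simp only [Finset.mem_filter, Finset.Nat.mem_antidiagonalTuple, Set.mem_ofPred_eq,
        Fin.cons_self_tail]
      refine ⟨?_, h2⟩
      simp only [Fin.tail]
      omega
  · intro x hx
    simp [Finset.Nat.mem_antidiagonalTuple, Fin.sum_univ_succ] at *
    omega

theorem stab (k : ℕ) (U : Set (Fin (k + 1) → ℕ)) (hU : IsUpperSet U) :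
    ∃ N, ∀ n, N ≤ n → {x : Fin k → ℕ | (Fin.cons n x : Fin (k+1) → ℕ) ∈ U} =
      {x | (Fin.cons N x : Fin (k+1) → ℕ) ∈ U} := by
  have hfin : {x | Minimal (· ∈ U) x}.Finite :=
    WellQuasiOrderedLE.finite_of_isAntichain
      (setOfPred_minimal_antichain _)
  obtain ⟨N, hN⟩ := (hfin.image (fun x => x 0)).bddAbove
  refine ⟨N, fun n hn => ?_⟩
  ext x
  simp only [Set.mem_ofPred_eq]
  constructor
  · intro hx
    obtain ⟨y, hy, hmin⟩ := exists_minimal_le_of_wellFoundedLT (· ∈ U) _ hx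
    refine hU ?_ hmin.1
    intro i
    refine Fin.cases ?_ (fun j => ?_) i
    · exact hN ⟨y, hmin, rfl⟩
    · simpa using hy j.succ
  · intro hx
    refine hU ?_ hx
    intro i
    refine Fin.cases ?_ (fun j => ?_) i
    · simpa using hn
    · simp

theorem cnt_evPoly (k : ℕ) : ∀ U : Set (Fin k → ℕ), IsUpperSet U →
    EvPoly (fun h => (cnt k U h : ℚ)) := by
  induction k with
  | zero =>
    intro U _
    refine (EvPoly.const 0).congr 1 fun n hn => ?_
    obtain ⟨m, rfl⟩ : ∃ m, n = m + 1 := ⟨n - 1, by omega⟩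
    simp [cnt]
  | succ k ih =>
    intro U hU
    obtain ⟨N, hN⟩ := stab k U hU
    have hup : ∀ n, IsUpperSet {x : Fin k → ℕ | (Fin.cons n x : Fin (k+1) → ℕ) ∈ U} := by
      intro n x y hxy hx
      refine hU ?_ hx
      intro i
      refine Fin.cases ?_ (fun j => ?_) i
      · simp
      · simpa using hxy j
    have h1 := EvPoly.sum (f := fun n h =>
      (cnt k {x : Fin k → ℕ | (Fin.cons n x : Fin (k+1) → ℕ) ∈ U} (h - n) : ℚ)) N
      (fun n => (ih _ (hup n)).shift n)
    have h2 := (ih _ (hup N)).partialSum.shift N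
    refine (h1.add h2).congr N fun n hn => ?_
    obtain ⟨m, rfl⟩ := Nat.exists_eq_add_of_le hn
    rw [cnt_succ, add_assoc, Finset.sum_range_add]
    push_cast
    congr 1
    rw [← Finset.sum_range_reflect]
    refine Finset.sum_congr (by simp) fun j hj => ?_
    simp only [Finset.mem_range] at hj
    rw [hN _ (by omega)]
    congr 2
    omega

theorem iterSumset_eq {d k : ℕ} (a : Fin k → (Fin d → ℤ)) (h : ℕ) :
    iterSumset (Set.range a) h =
      (fun x : Fin k → ℕ => ∑ i, x i • a i) '' {x | ∑ i, x i = h} := by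
  induction h with
  | zero =>
    ext v
    simp only [iterSumset, Set.mem_singleton_iff, Set.mem_image, Set.mem_ofPred_eq]
    constructor
    · rintro rfl
      exact ⟨0, by simp, by simp⟩
    · rintro ⟨x, hx, rfl⟩
      simp at hx
      simp [hx]
  | succ h ih =>
    ext v
    simp only [iterSumset, ih, Set.mem_add, Set.mem_image, Set.mem_ofPred_eq, Set.mem_range]
    constructor
    · rintro ⟨_, ⟨i, rfl⟩, _, ⟨x, hx, rfl⟩, rfl⟩
      refine ⟨Pi.single i 1 + x, ?_, ?_⟩
      · simp [Finset.sum_add_distrib, hx, add_comm]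
      · simp [add_smul, Finset.sum_add_distrib, Pi.single_apply, ite_smul]
    · rintro ⟨x, hx, rfl⟩
      obtain ⟨i, hi⟩ : ∃ i, x i ≠ 0 := by
        by_contra! hc
        simp [hc] at hx
      have hxi : x = Pi.single i 1 + (x - Pi.single i 1) := by
        symm
        apply add_tsub_cancel_of_le
        intro j
        rcases eq_or_ne j i with rfl | hj
        · simp; omega
        · simp [hj]
      generalize x - Pi.single i 1 = y at hxi
      subst hxi
      refine ⟨a i, ⟨i, rfl⟩, _, ⟨y, ?_, rfl⟩, ?_⟩
      · simp [Finset.sum_add_distrib] at hx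
        omega
      · simp [add_smul, Finset.sum_add_distrib, Pi.single_apply, ite_smul]

/-- Vectors with a lexicographically smaller equivalent representation. -/
def useless {d k : ℕ} (a : Fin k → (Fin d → ℤ)) : Set (Fin k → ℕ) :=
  {x | ∃ y, toLex y < toLex x ∧ ∑ i, y i = ∑ i, x i ∧ ∑ i, y i • a i = ∑ i, x i • a i}

theorem useless_upper {d k : ℕ} (a : Fin k → (Fin d → ℤ)) : IsUpperSet (useless a) := by
  rintro x z hxz ⟨y, hlt, hs, he⟩
  obtain ⟨w, rfl⟩ := exists_add_of_le hxz
  refine ⟨y + w, ?_, ?_, ?_⟩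
  · rw [toLex_add, toLex_add]
    exact add_lt_add_left hlt _
  · simp [Finset.sum_add_distrib, hs]
  · simp only [Pi.add_apply, Finset.sum_add_distrib, add_smul, he]

theorem ncard_eq {d k : ℕ} (a : Fin k → (Fin d → ℤ)) (h : ℕ) :
    (iterSumset (Set.range a) h).ncard = cnt k (useless a) h := by
  classical
  rw [iterSumset_eq, cnt, ← Set.ncard_coe_finset]
  rw [← Set.ncard_image_of_injOn (f := fun x : Fin k → ℕ => ∑ i, x i • a i)]
  · congr 1
    ext v
    constructor
    · rintro ⟨x, hx, rfl⟩
      simp only [Set.mem_ofPred_eq] at hx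
      obtain ⟨y, hy, hmin⟩ := Finset.exists_min_image
        ((Finset.Nat.antidiagonalTuple k h).filter
          (fun y => ∑ i, y i • a i = ∑ i, x i • a i)) (fun y => toLex y)
        ⟨x, by simp [Finset.Nat.mem_antidiagonalTuple, hx]⟩
      simp only [Finset.mem_filter, Finset.Nat.mem_antidiagonalTuple] at hy hmin
      refine ⟨y, ?_, hy.2⟩
      simp only [Finset.coe_filter, Finset.Nat.mem_antidiagonalTuple, Set.mem_ofPred_eq]
      refine ⟨hy.1, ?_⟩
      rintro ⟨z, hlt, hs, he⟩
      exact absurd hlt (not_lt.2 (hmin z ⟨hs.trans hy.1, he.trans hy.2⟩))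
    · rintro ⟨x, hx, rfl⟩
      simp only [Finset.coe_filter, Finset.Nat.mem_antidiagonalTuple, Set.mem_ofPred_eq] at hx
      exact ⟨x, hx.1, rfl⟩
  · intro x hx y hy hxy
    simp only [Finset.coe_filter, Finset.Nat.mem_antidiagonalTuple, Set.mem_ofPred_eq] at hx hy hxy
    rcases lt_trichotomy (toLex x) (toLex y) with hlt | heq | hlt
    · exact absurd ⟨x, hlt, hx.1.trans hy.1.symm, hxy⟩ hy.2
    · exact toLex.injective heq
    · exact absurd ⟨y, hlt, hy.1.trans hx.1.symm, hxy.symm⟩ hx.2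

theorem ncard_bound {d : ℕ} (A : Set (Fin d → ℤ)) (hfin : A.Finite) :
    ∃ M : ℕ, ∀ h, (iterSumset A h).ncard ≤ (2 * (M * h) + 1) ^ d := by
  obtain ⟨M, hM⟩ : ∃ M : ℕ, ∀ a ∈ A, ∀ i, |a i| ≤ M := by
    obtain ⟨M, hM⟩ := (hfin.image (fun a => ∑ i, (a i).natAbs)).bddAbove
    refine ⟨M, fun a ha i => ?_⟩
    have h1 : (a i).natAbs ≤ ∑ i, (a i).natAbs :=
      Finset.single_le_sum (f := fun i => (a i).natAbs) (fun _ _ => Nat.zero_le _)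
        (Finset.mem_univ i)
    have h2 : ∑ i, (a i).natAbs ≤ M := hM ⟨a, ha, rfl⟩
    rw [Int.abs_eq_natAbs]
    exact_mod_cast h1.trans h2
  refine ⟨M, fun h => ?_⟩
  have key : ∀ h : ℕ, ∀ v ∈ iterSumset A h, ∀ i, |v i| ≤ ((M * h : ℕ) : ℤ) := by
    intro h
    induction h with
    | zero =>
      intro v hv i
      have : v = 0 := hv
      simp [this]
    | succ h ih =>
      rintro _ ⟨a, ha, v, hv, rfl⟩ i
      have h1 := hM a ha i
      have h2 := ih v hv i
      have h3 := abs_add_le (a i) (v i)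
      simp only [Pi.add_apply]
      push_cast at *
      linarith
  have hsub : iterSumset A h ⊆
      (Fintype.piFinset (fun _ : Fin d => Finset.Icc (-((M * h : ℕ) : ℤ)) ((M * h : ℕ) : ℤ)) :
        Finset (Fin d → ℤ)) := by
    intro v hv
    simp only [Finset.mem_coe, Fintype.mem_piFinset, Finset.mem_Icc]
    exact fun i => abs_le.1 (key h v hv i)
  refine (Set.ncard_le_ncard hsub (Finset.finite_toSet _)).trans ?_
  rw [Set.ncard_coe_finset, Fintype.card_piFinset]
  simp only [Int.card_Icc, Finset.prod_const, Finset.card_univ, Fintype.card_fin]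
  apply Nat.pow_le_pow_left
  omega

theorem degree_bound (p : Polynomial ℚ) (d M H : ℕ)
    (h0 : ∀ h : ℕ, H ≤ h → 0 ≤ p.eval (h : ℚ))
    (h1 : ∀ h : ℕ, H ≤ h → p.eval (h : ℚ) ≤ (2 * (M * h) + 1) ^ d) : p.natDegree ≤ d := by
  by_contra! hc
  have hdeg : (Polynomial.X ^ d : Polynomial ℚ).degree < p.degree := by
    rw [Polynomial.degree_X_pow]
    rw [Polynomial.degree_eq_natDegree (by rintro rfl; simp at hc)]
    exact_mod_cast hc
  have hT := (Polynomial.abs_div_tendsto_atTop_atTop_of_degree_gt p (Polynomial.X ^ d) hdeg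
    (by simp)).comp (tendsto_natCast_atTop_atTop (R := ℚ))
  obtain ⟨n, hn1, hn2, hn3⟩ := ((hT.eventually_gt_atTop ((2 * M + 1 : ℚ) ^ d)).and
    ((Filter.eventually_ge_atTop H).and (Filter.eventually_ge_atTop 1))).exists
  simp only [Function.comp, Polynomial.eval_pow, Polynomial.eval_X] at hn1
  have hn : (1 : ℚ) ≤ n := by exact_mod_cast hn3
  have hpos : (0 : ℚ) < (n : ℚ) ^ d := by positivity
  rw [abs_of_nonneg (div_nonneg (h0 n hn2) hpos.le), lt_div_iff₀ hpos, ← mul_pow] at hn1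
  have h3 := h1 n hn2
  have h4 : (2 * (M * n) + 1 : ℚ) ^ d ≤ ((2 * M + 1) * n) ^ d := by
    apply pow_le_pow_left₀ (by positivity)
    linarith
  linarith

theorem khovanskii (d : ℕ) (hd : 1 ≤ d) (A : Set (Fin d → ℤ))
    (hfin : A.Finite) (hne : A.Nonempty) :
    ∃ (p : Polynomial ℚ) (H : ℕ), p.natDegree ≤ d ∧
      ∀ h : ℕ, H ≤ h → ((iterSumset A h).ncard : ℚ) = p.eval (h : ℚ) := by
  obtain ⟨k, a, ha⟩ : ∃ (k : ℕ) (a : Fin k → (Fin d → ℤ)), Set.range a = A := by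
    obtain ⟨k, a, _, ha⟩ := hfin.fin_param
    exact ⟨k, a, ha⟩
  obtain ⟨M, hM⟩ := ncard_bound A hfin
  obtain ⟨p, H, hp⟩ := cnt_evPoly k (useless a) (useless_upper a)
  have hq : ∀ h : ℕ, H ≤ h → ((iterSumset A h).ncard : ℚ) = p.eval (h : ℚ) := by
    intro h hh
    rw [← ha, ncard_eq, ← hp h hh]
  refine ⟨p, H, degree_bound p d M H (fun h hh => ?_) (fun h hh => ?_), hq⟩
  · rw [← hq h hh]
    positivity
  · rw [← hq h hh]
    exact_mod_cast hM h
end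

section
/- Let d ≥ 1, let A ⊆ ℤ^d be a set of exactly d+2 elements such that A − A generates ℤ^d as an additive group, and let V be a natural number satisfying (V : ℝ) = d! · vol(Δ_A). Then for every natural number h with h + d + 1 ≥ V, |hA| = binom(h + d + 1, d + 1) − binom(h + d + 1 − V, d + 1). -/
open Pointwise MeasureTheory

section helpers
open Finset

theorem mem_iterSumset_range {ι G : Type*} [Fintype ι] [DecidableEq ι] [AddCommMonoid G]
    (a : ι → G) (h : ℕ) (v : G) :
    v ∈ iterSumset (Set.range a) h ↔ ∃ x : ι → ℕ, ∑ i, x i = h ∧ ∑ i, x i • a i = v := by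
  induction h generalizing v with
  | zero =>
    simp only [iterSumset, Set.mem_singleton_iff]
    constructor
    · rintro rfl
      exact ⟨0, by simp, by simp⟩
    · rintro ⟨x, hx, rfl⟩
      have : ∀ i, x i = 0 := by simpa using hx
      simp [this]
  | succ n ih =>
    simp only [iterSumset, Set.mem_add]
    constructor
    · rintro ⟨_, ⟨i, rfl⟩, w, hw, rfl⟩
      obtain ⟨x, hx, rfl⟩ := (ih w).1 hw
      refine ⟨Pi.single i 1 + x, ?_, ?_⟩
      · simp [Finset.sum_add_distrib, hx, add_comm]
      · simp only [Pi.add_apply, add_smul, Finset.sum_add_distrib]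
        congr 1
        rw [Finset.sum_eq_single i]
        · simp
        · intro b _ hb
          simp [hb]
        · simp
    · rintro ⟨x, hx, rfl⟩
      have : ∃ i, x i ≠ 0 := by
        by_contra hcon
        push Not at hcon
        simp [hcon] at hx
      obtain ⟨i, hi⟩ := this
      obtain ⟨y, rfl⟩ : ∃ y : ι → ℕ, x = Pi.single i 1 + y := by
        refine ⟨fun j => x j - (Pi.single i 1 : ι → ℕ) j, ?_⟩
        ext j
        by_cases hj : j = i
        · subst hj; simp; omega
        · simp [hj]
      refine ⟨a i, ⟨i, rfl⟩, ∑ j, y j • a j, (ih _).2 ⟨y, ?_, rfl⟩, ?_⟩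
      · simp [Finset.sum_add_distrib] at hx
        omega
      · simp only [Pi.add_apply, add_smul, Finset.sum_add_distrib]
        congr 1
        symm
        rw [Finset.sum_eq_single i]
        · simp
        · intro b _ hb
          simp [hb]
        · simp

theorem ncard_comps (n h : ℕ) :
    {x : Fin (n + 1) → ℕ | ∑ i, x i = h}.ncard = (h + n).choose n := by
  have : {x : Fin (n + 1) → ℕ | ∑ i, x i = h} =
      ((piAntidiag (univ : Finset (Fin (n+1))) h : Finset (Fin (n + 1) → ℕ)) : Set _) := by
    ext x; simp
  rw [this, Set.ncard_coe_finset, ← map_sym_eq_piAntidiag, Finset.card_map]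
  simp only [Finset.sym_univ, Finset.card_univ]
  rw [Sym.card_sym_eq_choose, Fintype.card_fin]
  rw [show n + 1 + h - 1 = h + n by omega, Nat.choose_symm_add]

theorem finite_comps (n h : ℕ) : {x : Fin n → ℕ | ∑ i, x i = h}.Finite := by
  have : {x : Fin n → ℕ | ∑ i, x i = h} =
      ((piAntidiag (univ : Finset (Fin n)) h : Finset (Fin n → ℕ)) : Set _) := by
    ext x; simp
  rw [this]; exact Finset.finite_toSet _

/-- compositions dominating `p` -/
theorem ncard_comps_ge (n h : ℕ) (hn : n ≠ 0) (p : Fin (n + 1) → ℕ) :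
    {x : Fin (n + 1) → ℕ | ∑ i, x i = h ∧ p ≤ x}.ncard =
      (h + n - ∑ i, p i).choose n := by
  by_cases hp : ∑ i, p i ≤ h
  · have : {x : Fin (n + 1) → ℕ | ∑ i, x i = h ∧ p ≤ x} =
      (fun y => y + p) '' {x : Fin (n + 1) → ℕ | ∑ i, x i = h - ∑ i, p i} := by
      ext x
      simp only [Set.mem_ofPred_eq, Set.mem_image]
      constructor
      · rintro ⟨hx, hpx⟩
        refine ⟨x - p, ?_, tsub_add_cancel_of_le hpx⟩
        have := congrArg (fun z => ∑ i, z i) (tsub_add_cancel_of_le hpx)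
        simp only [Pi.add_apply, Finset.sum_add_distrib] at this
        omega
      · rintro ⟨y, hy, rfl⟩
        refine ⟨?_, le_add_self⟩
        simp only [Pi.add_apply, Finset.sum_add_distrib]
        omega
    rw [this, Set.ncard_image_of_injective _ (add_left_injective p), ncard_comps]
    congr 1; omega
  · have : {x : Fin (n + 1) → ℕ | ∑ i, x i = h ∧ p ≤ x} = ∅ := by
      ext x
      simp only [Set.mem_ofPred_eq, Set.mem_empty_iff_false, iff_false]
      rintro ⟨rfl, hx⟩
      exact hp (Finset.sum_le_sum fun i _ => hx i)
    rw [this, Set.ncard_empty]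
    push Not at hp
    symm
    apply Nat.choose_eq_zero_of_lt
    omega

/-- exact count, for every `h`. -/
theorem ncard_iterSumset (d : ℕ) (a : Fin (d + 2) → (Fin d → ℤ)) (l : Fin (d + 2) → ℤ)
    (hl0 : ∑ i, l i = 0) (hla : ∑ i, l i • a i = 0) (hne : l ≠ 0)
    (hker : ∀ x : Fin (d + 2) → ℤ, ∑ i, x i = 0 → ∑ i, x i • a i = 0 → ∃ k : ℤ, x = k • l)
    (h : ℕ) :
    (iterSumset (Set.range a) h).ncard = (h + d + 1).choose (d + 1) -
      (h + d + 1 - ∑ i, (l i).toNat).choose (d + 1) := by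
  set p : Fin (d + 2) → ℕ := fun i => (l i).toNat with hp
  set f : (Fin (d + 2) → ℕ) → (Fin d → ℤ) := fun x => ∑ i, x i • a i with hf
  have hpos : ∃ i, 0 < l i := by
    by_contra hcon
    push Not at hcon
    apply hne
    ext i
    exact (Finset.sum_eq_zero_iff_of_nonpos (fun i _ => hcon i)).1 hl0 i (mem_univ i)
  obtain ⟨i0, hi0⟩ := hpos
  have key : ∀ x y : Fin (d + 2) → ℕ, ∑ i, x i = h → ∑ i, y i = h → f x = f y →
      ∃ k : ℤ, ∀ i, (x i : ℤ) - y i = k * l i := by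
    intro x y hx hy hxy
    obtain ⟨k, hk⟩ := hker (fun i => (x i : ℤ) - y i)
      (by rw [Finset.sum_sub_distrib]; norm_cast; simp [hx, hy])
      (by simp only [sub_smul, Finset.sum_sub_distrib, natCast_zsmul]; exact sub_eq_zero.2 hxy)
    exact ⟨k, fun i => by simpa using congrFun hk i⟩
  have haux : ∀ x y : Fin (d + 2) → ℕ, ∀ k : ℤ, 1 ≤ k → (∀ i, (x i : ℤ) - y i = k * l i) → p ≤ x := by
    intro x y k hk hxy i
    simp only [hp]
    have := hxy i
    rcases le_or_gt (l i) 0 with hli | hli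
    · simp [Int.toNat_of_nonpos hli]
    · have : l i ≤ k * l i := by nlinarith
      omega
  have himg : iterSumset (Set.range a) h =
      f '' ({x : Fin (d + 2) → ℕ | ∑ i, x i = h} \ {x | ∑ i, x i = h ∧ p ≤ x}) := by
    ext v
    rw [mem_iterSumset_range]
    simp only [Set.mem_image, Set.mem_sdiff, Set.mem_ofPred_eq]
    constructor
    · rintro ⟨x, hx, hv⟩
      induction hm : x i0 using Nat.strong_induction_on generalizing x with
      | _ m ih =>
        by_cases hpx : p ≤ x
        · have hnn : ∀ i, l i ≤ x i := fun i => by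
            have := hpx i
            simp only [hp] at this
            omega
          have hcast : ∀ i, (((x i : ℤ) - l i).toNat : ℤ) = x i - l i := fun i => by
            have := hnn i
            omega
          refine ih ((x i0 : ℤ) - l i0).toNat ?_ (fun i => ((x i : ℤ) - l i).toNat) ?_ ?_ rfl
          · have := hnn i0
            omega
          · zify
            simp only [hcast, Finset.sum_sub_distrib, hl0, sub_zero]
            exact_mod_cast hx
          · rw [← hv]
            simp only [← natCast_zsmul, hcast, sub_smul, Finset.sum_sub_distrib, hla, sub_zero]
        · exact ⟨x, ⟨hx, fun h' => hpx h'.2⟩, hv⟩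
    · rintro ⟨x, ⟨hx, -⟩, hv⟩
      exact ⟨x, hx, hv⟩
  rw [himg, Set.InjOn.ncard_image, Set.ncard_sdiff (fun x hx => hx.1)
    ((finite_comps _ h).subset (fun x hx => hx.1)),
    ncard_comps (d+1), ncard_comps_ge (d+1) h (by omega)]
  · rfl
  · rintro x ⟨hx, hx'⟩ y ⟨hy, hy'⟩ hxy
    simp only [Set.mem_ofPred_eq] at hx hx' hy hy'
    obtain ⟨k, hk⟩ := key x y hx hy hxy
    rcases lt_trichotomy k 0 with hk0 | hk0 | hk0
    · exact absurd ⟨hy, haux y x (-k) (by omega) (fun i => by have := hk i; linarith)⟩ hy'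
    · ext i
      have := hk i
      simp [hk0] at this
      omega
    · exact (hx' ⟨hx, haux x y k (by omega) hk⟩).elim

/-- existence of the primitive affine relation -/
theorem exists_rel (d : ℕ) (a : Fin (d + 2) → (Fin d → ℤ))
    (hsurj : ∀ (v : Fin d → ℤ) (k : ℤ), ∃ x : Fin (d + 2) → ℤ, ∑ i, x i = k ∧ ∑ i, x i • a i = v) :
    ∃ l : Fin (d + 2) → ℤ, ∑ i, l i = 0 ∧ ∑ i, l i • a i = 0 ∧ l ≠ 0 ∧
    (∀ x : Fin (d + 2) → ℤ, ∑ i, x i = 0 → ∑ i, x i • a i = 0 → ∃ k : ℤ, x = k • l) := by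
  let L : (Fin (d + 2) → ℤ) →ₗ[ℤ] (Fin d → ℤ) × ℤ :=
    { toFun := fun x => (∑ i, x i • a i, ∑ i, x i)
      map_add' := fun x y => by simp [add_smul, Finset.sum_add_distrib]
      map_smul' := fun c x => by simp [mul_smul, Finset.smul_sum, Finset.mul_sum] }
  have hL : Function.Surjective L := by
    rintro ⟨v, k⟩
    obtain ⟨x, h1, h2⟩ := hsurj v k
    exact ⟨x, Prod.ext h2 h1⟩
  have hfr := Submodule.finrank_quotient_add_finrank (LinearMap.ker L)
  rw [(L.quotKerEquivOfSurjective hL).finrank_eq] at hfr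
  simp only [Module.finrank_prod, Module.finrank_fintype_fun_eq_card, Fintype.card_fin,
    Module.finrank_self] at hfr
  have h1 : Module.finrank ℤ (LinearMap.ker L) = 1 := by omega
  let b := Module.finBasisOfFinrankEq ℤ _ h1
  have hm : ∀ x, x ∈ LinearMap.ker L ↔ ∑ i, x i = 0 ∧ ∑ i, x i • a i = 0 := by
    intro x
    rw [LinearMap.mem_ker, and_comm]
    exact Prod.ext_iff
  have hb := (hm _).1 (b 0).2
  refine ⟨(b 0 : Fin (d + 2) → ℤ), hb.1, hb.2, ?_, ?_⟩
  · intro h0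
    exact b.ne_zero 0 (Subtype.ext h0)
  · intro x hx1 hx2
    have := b.sum_repr ⟨x, (hm x).2 ⟨hx1, hx2⟩⟩
    simp only [Fin.sum_univ_one] at this
    exact ⟨_, (congrArg Subtype.val this).symm⟩

theorem surj_of_gen (d : ℕ) (a : Fin (d + 2) → (Fin d → ℤ))
    (hgen : AddSubgroup.closure (Set.range a - Set.range a) = ⊤) :
    ∀ (v : Fin d → ℤ) (k : ℤ), ∃ x : Fin (d + 2) → ℤ, ∑ i, x i = k ∧ ∑ i, x i • a i = v := by
  have h0 : ∀ v : Fin d → ℤ, ∃ x : Fin (d + 2) → ℤ, ∑ i, x i = 0 ∧ ∑ i, x i • a i = v := by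
    intro v
    have hv : v ∈ AddSubgroup.closure (Set.range a - Set.range a) := by rw [hgen]; trivial
    induction hv using AddSubgroup.closure_induction with
    | mem x hx =>
      obtain ⟨_, ⟨i, rfl⟩, _, ⟨j, rfl⟩, rfl⟩ := hx
      refine ⟨Pi.single i 1 - Pi.single j 1, by simp, ?_⟩
      simp [sub_smul, Finset.sum_sub_distrib, Pi.single_apply, ite_smul]
    | zero => exact ⟨0, by simp, by simp⟩
    | add x y _ _ hx hy =>
      obtain ⟨x', h1, rfl⟩ := hx
      obtain ⟨y', h2, rfl⟩ := hy
      exact ⟨x' + y', by simp [Finset.sum_add_distrib, h1, h2],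
        by simp [add_smul, Finset.sum_add_distrib]⟩
    | neg x _ hx =>
      obtain ⟨x', h1, rfl⟩ := hx
      exact ⟨-x', by simp [h1], by simp⟩
  intro v k
  obtain ⟨x, h1, h2⟩ := h0 (v - k • a 0)
  refine ⟨x + Pi.single 0 k, by simp [Finset.sum_add_distrib, h1], ?_⟩
  simp only [Pi.add_apply, add_smul, Finset.sum_add_distrib, h2]
  simp [Pi.single_apply, ite_smul]


open Filter Topology

theorem tendsto_ratio (K : ℕ) : Tendsto (fun n : ℕ => (((n + K : ℕ) : ℝ) / n)) atTop (𝓝 1) := by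
  have h : Tendsto (fun n : ℕ => 1 + (K : ℝ) / n) atTop (𝓝 (1 + 0)) :=
    tendsto_const_nhds.add (tendsto_const_div_atTop_nhds_zero_nat (K : ℝ))
  rw [add_zero] at h
  refine h.congr' ?_
  filter_upwards [eventually_ge_atTop 1] with n hn
  have : (n : ℝ) ≠ 0 := by positivity
  push_cast
  field_simp

theorem tendsto_shift (f : ℕ → ℝ) (d K : ℕ) (c : ℝ)
    (hf : Tendsto (fun n : ℕ => f n / (n : ℝ) ^ d) atTop (𝓝 c)) :
    Tendsto (fun n : ℕ => f (n + K) / (n : ℝ) ^ d) atTop (𝓝 c) := by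
  have h1 := (hf.comp (tendsto_add_atTop_nat K)).mul ((tendsto_ratio K).pow d)
  rw [one_pow, mul_one] at h1
  refine h1.congr' ?_
  filter_upwards [eventually_ge_atTop 1] with n hn
  have : (n : ℝ) ≠ 0 := by positivity
  have h2 : ((n + K : ℕ) : ℝ) ≠ 0 := by positivity
  simp only [Function.comp]
  rw [div_pow]
  field_simp

theorem tendsto_unshift (f : ℕ → ℝ) (d K : ℕ) (c : ℝ)
    (hf : Tendsto (fun n : ℕ => f (n + K) / (n : ℝ) ^ d) atTop (𝓝 c)) :
    Tendsto (fun n : ℕ => f n / (n : ℝ) ^ d) atTop (𝓝 c) := by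
  rw [← tendsto_add_atTop_iff_nat K]
  have h1 := hf.mul (((tendsto_ratio K).inv₀ one_ne_zero).pow d)
  rw [inv_one, one_pow, mul_one] at h1
  refine h1.congr' ?_
  filter_upwards [eventually_ge_atTop 1] with n hn
  have : (n : ℝ) ≠ 0 := by positivity
  have h2 : ((n + K : ℕ) : ℝ) ≠ 0 := by positivity
  rw [inv_div, div_pow]
  field_simp

theorem tendsto_choose_div (d : ℕ) :
    Tendsto (fun n : ℕ => (n.choose d : ℝ) / (n : ℝ) ^ d) atTop (𝓝 (1 / d.factorial)) := by
  have h := isEquivalent_choose d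
  have hz : ∀ᶠ n : ℕ in atTop, ((n : ℝ) ^ d / d.factorial) ≠ 0 := by
    filter_upwards [eventually_ge_atTop 1] with n hn
    positivity
  rw [Asymptotics.isEquivalent_iff_tendsto_one hz] at h
  have h2 := h.mul_const (1 / (d.factorial : ℝ))
  rw [one_mul] at h2
  refine h2.congr' ?_
  filter_upwards [eventually_ge_atTop 1] with n hn
  have : (n : ℝ) ≠ 0 := by positivity
  have : (d.factorial : ℝ) ≠ 0 := by positivity
  simp only [Pi.div_apply]
  field_simp

theorem choose_diff (m e W : ℕ) :
    (m + W).choose (e + 1) = m.choose (e + 1) + ∑ j ∈ range W, (m + j).choose e := by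
  induction W with
  | zero => simp
  | succ W ih =>
    rw [Finset.sum_range_succ, ← add_assoc, Nat.choose_succ_succ, ih]
    ring

theorem tendsto_count (d W : ℕ) :
    Tendsto (fun n : ℕ => (((n + d + 1).choose (d + 1) - (n + d + 1 - W).choose (d + 1) : ℕ) : ℝ) /
      (n : ℝ) ^ d) atTop (𝓝 (W / d.factorial)) := by
  refine tendsto_unshift (fun n => (((n + d + 1).choose (d + 1) -
    (n + d + 1 - W).choose (d + 1) : ℕ) : ℝ)) d W _ ?_
  have h : Tendsto (fun n : ℕ => ∑ j ∈ range W, ((n + (d + 1 + j)).choose d : ℝ) / (n : ℝ) ^ d) atTop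
      (𝓝 (∑ j ∈ range W, 1 / (d.factorial : ℝ))) :=
    tendsto_finsetSum _ fun j _ =>
      tendsto_shift (fun n => (n.choose d : ℝ)) d (d + 1 + j) _ (tendsto_choose_div d)
  simp only [Finset.sum_const, card_range, nsmul_eq_mul, mul_one_div] at h
  refine h.congr fun n => ?_
  rw [← Finset.sum_div]
  congr 1
  rw [show n + W + d + 1 - W = n + d + 1 by omega, show n + W + d + 1 = n + d + 1 + W by omega,
    choose_diff, Nat.add_sub_cancel_left]
  push_cast
  simp only [← add_assoc]

/-- Integer points of the dilate. -/
def dilatePts (d : ℕ) (a : Fin (d + 2) → (Fin d → ℤ)) (n : ℕ) : Set (Fin d → ℤ) :=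
  {v | ∃ w : Fin (d + 2) → ℝ, (∀ i, 0 ≤ w i) ∧ ∑ i, w i = n ∧ ∀ j, ∑ i, w i * (a i j : ℝ) = v j}

theorem iterSumset_subset_dilate (d : ℕ) (a : Fin (d + 2) → (Fin d → ℤ)) (n : ℕ) :
    iterSumset (Set.range a) n ⊆ dilatePts d a n := by
  intro v hv
  obtain ⟨x, hx, rfl⟩ := (mem_iterSumset_range a n v).1 hv
  refine ⟨fun i => x i, fun i => by positivity, by simp only [← hx]; push_cast; rfl, fun j => ?_⟩
  simp

theorem finite_iterSumset (d : ℕ) (a : Fin (d + 2) → (Fin d → ℤ)) (n : ℕ) :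
    (iterSumset (Set.range a) n).Finite := by
  have : iterSumset (Set.range a) n = (fun x : Fin (d + 2) → ℕ => ∑ i, x i • a i) ''
      {x | ∑ i, x i = n} := by
    ext v; rw [mem_iterSumset_range]; rfl
  rw [this]
  exact (finite_comps _ _).image _

theorem exists_dilate_shift (d : ℕ) (a : Fin (d + 2) → (Fin d → ℤ))
    (hsurj : ∀ (v : Fin d → ℤ) (k : ℤ), ∃ x : Fin (d + 2) → ℤ, ∑ i, x i = k ∧ ∑ i, x i • a i = v) :
    ∃ (K : ℕ) (u : Fin d → ℤ), ∀ n, ∀ v ∈ dilatePts d a n,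
      v + u ∈ iterSumset (Set.range a) (n + K) := by
  choose σ hσ1 hσ2 using hsurj
  let B : ℤ := ∑ i, ∑ j, |a i j|
  let R : Set ((Fin d → ℤ) × ℤ) := Set.Icc (fun _ => -B) (fun _ => B) ×ˢ Set.Icc 0 (d + 2 : ℤ)
  have hR : R.Finite := (Set.finite_Icc _ _).prod (Set.finite_Icc _ _)
  obtain ⟨N, hN⟩ : ∃ N : ℕ, ∀ r ∈ R, ∀ i, -(N : ℤ) ≤ σ r.1 r.2 i := by
    obtain ⟨M, hM⟩ := (hR.image (fun r => ∑ i, (σ r.1 r.2 i).natAbs)).bddAbove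
    refine ⟨M, fun r hr i => ?_⟩
    have h1 := hM (Set.mem_image_of_mem _ hr)
    have h2 := Finset.single_le_sum (f := fun i => (σ r.1 r.2 i).natAbs) (fun _ _ => Nat.zero_le _)
      (mem_univ i)
    have h3 := h2.trans h1
    omega
  refine ⟨N * (d + 2), ∑ i, N • a i, fun n v hv => ?_⟩
  obtain ⟨w, hw0, hw1, hw2⟩ := hv
  set r : Fin d → ℤ := v - ∑ i, ⌊w i⌋ • a i with hr
  set k : ℤ := n - ∑ i, ⌊w i⌋ with hk
  have hrR : (r, k) ∈ R := by
    have hrf : ∀ j, (r j : ℝ) = ∑ i, Int.fract (w i) * (a i j : ℝ) := by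
      intro j
      simp only [hr, Pi.sub_apply, Finset.sum_apply, Pi.smul_apply, smul_eq_mul]
      push_cast
      rw [← hw2, ← Finset.sum_sub_distrib]
      refine Finset.sum_congr rfl fun i _ => ?_
      rw [Int.fract]; ring
    have hkf : (k : ℝ) = ∑ i, Int.fract (w i) := by
      simp only [hk]
      push_cast
      rw [← hw1, ← Finset.sum_sub_distrib]
      rfl
    have habs : ∀ j, |r j| ≤ B := by
      intro j
      have : |(r j : ℝ)| ≤ (∑ i, |a i j| : ℤ) := by
        rw [hrf]
        push_cast
        refine (Finset.abs_sum_le_sum_abs _ _).trans (Finset.sum_le_sum fun i _ => ?_)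
        rw [abs_mul, abs_of_nonneg (Int.fract_nonneg _)]
        exact mul_le_of_le_one_left (abs_nonneg _) (Int.fract_lt_one _).le
      have h2 : |r j| ≤ ∑ i, |a i j| := by exact_mod_cast this
      refine h2.trans (Finset.sum_le_sum fun i _ => ?_)
      exact Finset.single_le_sum (f := fun j => |a i j|) (fun _ _ => abs_nonneg _) (mem_univ j)
    have hk0 : (0 : ℤ) ≤ k := by
      have : (0 : ℝ) ≤ k := by rw [hkf]; exact Finset.sum_nonneg fun i _ => Int.fract_nonneg _
      exact_mod_cast this
    have hk1 : k ≤ (d + 2 : ℤ) := by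
      have : (k : ℝ) ≤ ∑ i : Fin (d + 2), (1 : ℝ) := by
        rw [hkf]; exact Finset.sum_le_sum fun i _ => (Int.fract_lt_one _).le
      simp at this
      exact_mod_cast this
    exact ⟨⟨fun j => (abs_le.1 (habs j)).1, fun j => (abs_le.1 (habs j)).2⟩, ⟨hk0, hk1⟩⟩
  have hnn : ∀ i, 0 ≤ ⌊w i⌋ + σ r k i + N := fun i => by
    have h1 := hN _ hrR i
    have h2 := Int.floor_nonneg.2 (hw0 i)
    simp only at h1
    omega
  rw [mem_iterSumset_range]
  refine ⟨fun i => (⌊w i⌋ + σ r k i + N).toNat, ?_, ?_⟩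
  · zify
    simp only [Int.toNat_of_nonneg (hnn _), Finset.sum_add_distrib, hσ1]
    simp [hk]
    ring
  · simp only [← natCast_zsmul, Int.toNat_of_nonneg (hnn _), add_smul, Finset.sum_add_distrib, hσ2]
    rw [hr]
    abel

theorem card_dilate (d : ℕ) (a : Fin (d + 2) → (Fin d → ℤ)) (n : ℕ) (hn : 1 ≤ n) :
    Nat.card ↑((convexHull ℝ ((fun (v : Fin d → ℤ) (i : Fin d) => (v i : ℝ)) '' Set.range a)) ∩
      (n : ℝ)⁻¹ • (Submodule.span ℤ (Set.range (Pi.basisFun ℝ (Fin d))) : Set (Fin d → ℝ))) =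
      (dilatePts d a n).ncard := by
  have hn0 : (n : ℝ) ≠ 0 := by positivity
  have : NeZero n := ⟨by omega⟩
  let φ : (Fin d → ℤ) → (Fin d → ℝ) := fun v j => (n : ℝ)⁻¹ * v j
  have hφ : Function.Injective φ := by
    intro v w hvw
    ext j
    have := congrFun hvw j
    simpa [φ, hn0] using this
  rw [Nat.card_coe_set_eq, ← Set.ncard_image_of_injective _ hφ]
  congr 1
  ext x
  have hmem : x ∈ ((n : ℝ)⁻¹ • (Submodule.span ℤ (Set.range (Pi.basisFun ℝ (Fin d))) : Set (Fin d → ℝ)))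
      ↔ ∀ i, n * x i ∈ Set.range (algebraMap ℤ ℝ) :=
    BoxIntegral.unitPartition.mem_smul_span_iff
  have hconv : x ∈ convexHull ℝ ((fun (v : Fin d → ℤ) (i : Fin d) => (v i : ℝ)) '' Set.range a) ↔
      ∃ w : Fin (d + 2) → ℝ, (∀ i, 0 ≤ w i) ∧ ∑ i, w i = 1 ∧ ∀ j, ∑ i, w i * (a i j : ℝ) = x j := by
    rw [← Set.range_comp]
    constructor
    · intro hx
      have hsub : convexHull ℝ (Set.range ((fun (v : Fin d → ℤ) (i : Fin d) => (v i : ℝ)) ∘ a)) ⊆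
          (Fintype.linearCombination ℝ ((fun (v : Fin d → ℤ) (i : Fin d) => (v i : ℝ)) ∘ a)) ''
            stdSimplex ℝ (Fin (d + 2)) := by
        refine convexHull_min ?_ ((convex_stdSimplex ℝ _).linear_image _)
        rintro _ ⟨i, rfl⟩
        exact ⟨Pi.single i 1, single_mem_stdSimplex ℝ i, by simp⟩
      obtain ⟨w, hw, rfl⟩ := hsub hx
      refine ⟨w, hw.1, hw.2, fun j => ?_⟩
      simp [Fintype.linearCombination_apply]
    · rintro ⟨w, hw0, hw1, hw2⟩
      refine mem_convexHull_of_exists_fintype w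
        ((fun (v : Fin d → ℤ) (i : Fin d) => (v i : ℝ)) ∘ a) hw0 hw1 (fun i => ⟨i, rfl⟩) ?_
      ext j
      simp [← hw2]
  rw [Set.mem_inter_iff, hmem, hconv]
  constructor
  · rintro ⟨⟨w, hw0, hw1, hw2⟩, hx⟩
    choose v hv using hx
    refine ⟨v, ⟨fun i => n * w i, fun i => mul_nonneg (by positivity) (hw0 i), ?_, fun j => ?_⟩, ?_⟩
    · rw [← Finset.mul_sum, hw1, mul_one]
    · simp only [mul_assoc, ← Finset.mul_sum, hw2]
      exact (hv j).symm
    · ext j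
      have := hv j
      simp only [φ]
      simp only [algebraMap_int_eq, eq_intCast] at this
      rw [this]
      field_simp
  · rintro ⟨v, ⟨w, hw0, hw1, hw2⟩, rfl⟩
    refine ⟨⟨fun i => (n : ℝ)⁻¹ * w i, fun i => mul_nonneg (by positivity) (hw0 i), ?_,
      fun j => ?_⟩, fun i => ⟨v i, ?_⟩⟩
    · rw [← Finset.mul_sum, hw1, inv_mul_cancel₀ hn0]
    · simp only [mul_assoc, ← Finset.mul_sum, hw2, φ]
    · simp [φ, hn0]

theorem volume_eq (d : ℕ) (a : Fin (d + 2) → (Fin d → ℤ)) (l : Fin (d + 2) → ℤ)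
    (hsurj : ∀ (v : Fin d → ℤ) (k : ℤ), ∃ x : Fin (d + 2) → ℤ, ∑ i, x i = k ∧ ∑ i, x i • a i = v)
    (hl0 : ∑ i, l i = 0) (hla : ∑ i, l i • a i = 0) (hne : l ≠ 0)
    (hker : ∀ x : Fin (d + 2) → ℤ, ∑ i, x i = 0 → ∑ i, x i • a i = 0 → ∃ k : ℤ, x = k • l) :
    (volume (convexHull ℝ ((fun (v : Fin d → ℤ) (i : Fin d) => (v i : ℝ)) '' Set.range a))).toReal =
      (∑ i, (l i).toNat : ℕ) / d.factorial := by
  set s := convexHull ℝ ((fun (v : Fin d → ℤ) (i : Fin d) => (v i : ℝ)) '' Set.range a) with hs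
  have hfin : ((fun (v : Fin d → ℤ) (i : Fin d) => (v i : ℝ)) '' Set.range a).Finite :=
    (Set.finite_range a).image _
  have hcpt : IsCompact s := hfin.isCompact_convexHull (𝕜 := ℝ)
  have hvol := tendsto_card_div_pow_atTop_volume s hcpt.isBounded hcpt.measurableSet
    ((convex_convexHull ℝ _).addHaar_frontier volume)
  rw [Fintype.card_fin] at hvol
  refine tendsto_nhds_unique hvol ?_
  obtain ⟨K, u, hK⟩ := exists_dilate_shift d a hsurj
  have hlim : Tendsto (fun n : ℕ => ((iterSumset (Set.range a) n).ncard : ℝ) / (n : ℝ) ^ d) atTop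
      (𝓝 ((∑ i, (l i).toNat : ℕ) / d.factorial)) := by
    simp_rw [ncard_iterSumset d a l hl0 hla hne hker]
    exact tendsto_count d _
  have hlim2 := tendsto_shift (fun n => ((iterSumset (Set.range a) n).ncard : ℝ)) d K _ hlim
  have hinj : ∀ n, Set.InjOn (fun v => v + u) (dilatePts d a n) :=
    fun n => (add_left_injective u).injOn
  have hdfin : ∀ n, (dilatePts d a n).Finite := fun n =>
    Set.Finite.of_finite_image ((finite_iterSumset d a (n + K)).subset
      (by rintro _ ⟨v, hv, rfl⟩; exact hK n v hv)) (hinj n)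
  refine tendsto_of_tendsto_of_tendsto_of_le_of_le' hlim hlim2 ?_ ?_
  · filter_upwards [eventually_ge_atTop 1] with n hn
    rw [card_dilate d a n hn]
    gcongr
    · exact hdfin n
    · exact iterSumset_subset_dilate d a n
  · filter_upwards [eventually_ge_atTop 1] with n hn
    rw [card_dilate d a n hn]
    have := Set.ncard_le_ncard_of_injOn (fun v => v + u) (fun v hv => hK n v hv) (hinj n)
      (finite_iterSumset d a (n + K))
    gcongr

end helpers

theorem size_dplus2_large_h (d : ℕ) (hd : 1 ≤ d) (A : Set (Fin d → ℤ))
    (hfin : A.Finite) (hcard : A.ncard = d + 2)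
    (hgen : AddSubgroup.closure (A - A) = ⊤)
    (V : ℕ)
    (hV : (V : ℝ) = (Nat.factorial d : ℝ) *
      (volume (convexHull ℝ ((fun (v : Fin d → ℤ) (i : Fin d) => (v i : ℝ)) '' A))).toReal) :
    ∀ h : ℕ, V ≤ h + d + 1 →
      (iterSumset A h).ncard = Nat.choose (h + d + 1) (d + 1) - Nat.choose (h + d + 1 - V) (d + 1) := by
  intro h _
  obtain ⟨a, rfl⟩ : ∃ a : Fin (d + 2) → (Fin d → ℤ), Set.range a = A := by
    have : Finite A := hfin
    let e := Finite.equivFinOfCardEq (α := A) (n := d + 2) (by rw [Nat.card_coe_set_eq, hcard])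
    refine ⟨fun i => (e.symm i : Fin d → ℤ), ?_⟩
    change Set.range (Subtype.val ∘ e.symm) = A
    rw [Set.range_comp, e.symm.range_eq_univ, Set.image_univ, Subtype.range_coe]
  have hsurj := surj_of_gen d a hgen
  obtain ⟨l, hl0, hla, hne, hker⟩ := exists_rel d a hsurj
  have hvol := volume_eq d a l hsurj hl0 hla hne hker
  have hVW : V = ∑ i, (l i).toNat := by
    have hf : (d.factorial : ℝ) ≠ 0 := by positivity
    rw [hvol, mul_div_cancel₀ _ hf] at hV
    exact_mod_cast hV
  rw [hVW]
  exact ncard_iterSumset d a l hl0 hla hne hker h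
end

section
/- Let d ≥ 1, let A ⊆ ℤ^d be finite with A − A generating ℤ^d as an additive group, and suppose v_1, …, v_{d+1} ∈ A are affinely independent over ℝ and A is contained in the convex hull of {v_1, …, v_{d+1}}. For i = 1, …, d+1 let T_i(A) := ⋃_{k≥0} k(A − v_i) ⊆ ℤ^d, where A − v_i := {a − v_i : a ∈ A}. Then for every natural number h satisfying h ≥ (d+1)·D − 2 − 2d (as integers), hA = ⋂_{i=1}^{d+1} (h·v_i + T_i(A)). -/
open Pointwise

/-- The lift of `v ∈ ℤ^d` to height 1 in `ℤ^(d+1)`. -/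
def liftZ {d : ℕ} (v : Fin d → ℤ) : Fin (d + 1) → ℤ := Fin.snoc v 1

theorem mem_iterSumset_iff {G : Type*} [AddCommMonoid G] (A : Set G) (n : ℕ) (x : G) :
    x ∈ iterSumset A n ↔ ∃ l : List G, l.length = n ∧ (∀ a ∈ l, a ∈ A) ∧ l.sum = x := by
  induction n generalizing x with
  | zero =>
    constructor
    · intro h
      exact ⟨[], rfl, by simp, by simpa [iterSumset] using h.symm⟩
    · rintro ⟨l, hl, -, rfl⟩
      rw [List.length_eq_zero_iff] at hl
      subst hl
      simp [iterSumset]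
  | succ n ih =>
    constructor
    · intro h
      obtain ⟨a, ha, y, hy, rfl⟩ := Set.mem_add.1 h
      obtain ⟨l, hl, hA, rfl⟩ := (ih y).1 hy
      refine ⟨a :: l, by simp [hl], ?_, by simp⟩
      intro b hb
      rcases List.mem_cons.1 hb with rfl | hb
      · exact ha
      · exact hA b hb
    · rintro ⟨l, hl, hA, rfl⟩
      cases l with
      | nil => simp at hl
      | cons a l =>
        refine Set.mem_add.2 ⟨a, hA a (by simp), l.sum, (ih _).2 ⟨l, by simpa using hl, ?_, rfl⟩,
          by simp⟩
        intro b hb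
        exact hA b (by simp [hb])

/-- Pigeonhole: a long list has a nonempty contiguous block with sum in `L`. -/
theorem exists_zero_block {G : Type*} [AddCommGroup G] (L : Submodule ℤ G) (D : ℕ)
    (hD : 0 < D) (hcard : Nat.card (G ⧸ L) = D) (l : List G) (hl : D ≤ l.length) :
    ∃ l₁ l₂ l₃ : List G, l = l₁ ++ l₂ ++ l₃ ∧ l₂ ≠ [] ∧ l₂.sum ∈ L := by
  classical
  have : Finite (G ⧸ L) := Nat.finite_of_card_ne_zero (by omega)
  have := Fintype.ofFinite (G ⧸ L)
  obtain ⟨i, j, hij, he⟩ := Fintype.exists_ne_map_eq_of_card_lt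
    (fun i : Fin (D + 1) => (L.mkQ (l.take i).sum : G ⧸ L))
    (by rw [← Nat.card_eq_fintype_card, hcard]; simp)
  have key : ∀ i j : ℕ, i < j → j ≤ D → (L.mkQ (l.take i).sum : G ⧸ L) = L.mkQ (l.take j).sum →
      ∃ l₁ l₂ l₃ : List G, l = l₁ ++ l₂ ++ l₃ ∧ l₂ ≠ [] ∧ l₂.sum ∈ L := by
    intro i j hij hj he
    have h1 : l.take j = l.take i ++ (l.take j).drop i := by
      conv_lhs => rw [← List.take_append_drop i (l.take j)]
      rw [List.take_take, min_eq_left hij.le]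
    refine ⟨l.take i, (l.take j).drop i, l.drop j, ?_, ?_, ?_⟩
    · rw [← h1, List.take_append_drop]
    · intro h
      have := congrArg List.length h
      simp at this
      omega
    · rw [h1, List.sum_append, map_add, left_eq_add] at he
      simpa using he
  rcases lt_or_gt_of_ne (fun h => hij (Fin.ext h) : (i : ℕ) ≠ j) with h | h
  · exact key i j h (by omega) he
  · exact key j i h (by omega) he.symm

section Abstract

variable {G : Type*} [AddCommGroup G] {ι : Type*} [Fintype ι] [DecidableEq ι]

theorem reduce_list (V : ι → G) (D : ℕ) (hD : 0 < D)
    (hcard : Nat.card (G ⧸ Submodule.span ℤ (Set.range V)) = D)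
    (φ : G →+ (ι → ℤ)) (hφV : ∀ i, φ (V i) = Pi.single i (D : ℤ))
    (B : Set G) (hB : ∀ b ∈ B, ∀ i, 0 ≤ φ b i) :
    ∀ (n : ℕ) (l : List G), l.length = n → (∀ b ∈ l, b ∈ B) →
      ∃ (t : List G) (m : ι → ℕ), t.length < D ∧ (∀ b ∈ t, b ∈ B ∧ b ∉ Set.range V) ∧
        l.sum = t.sum + ∑ j, m j • V j := by
  intro n
  induction n using Nat.strong_induction_on with
  | _ n ih =>
  intro l hn hl
  have main : ∀ l₁ l₂ l₃ : List G, l = l₁ ++ l₂ ++ l₃ → l₂ ≠ [] →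
      l₂.sum ∈ Submodule.span ℤ (Set.range V) →
      ∃ (t : List G) (m : ι → ℕ), t.length < D ∧ (∀ b ∈ t, b ∈ B ∧ b ∉ Set.range V) ∧
        l.sum = t.sum + ∑ j, m j • V j := by
    intro l₁ l₂ l₃ h h2 hs
    have hlen : 0 < l₂.length := List.length_pos_iff.2 h2
    obtain ⟨t, m, ht, htB, hsum⟩ := ih (l₁ ++ l₃).length (by
      rw [← hn, h]; simp; omega) (l₁ ++ l₃) rfl (by
      intro b hb
      apply hl
      rw [h]
      simp only [List.mem_append] at hb ⊢
      tauto)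
    obtain ⟨c, hc⟩ := (Submodule.mem_span_range_iff_exists_fun ℤ).1 hs
    have hφ : ∀ j, φ l₂.sum j = c j * D := by
      intro j
      rw [← hc, map_sum, Finset.sum_apply, Finset.sum_eq_single j]
      · rw [map_zsmul, hφV]; simp
      · intro b _ hb
        rw [map_zsmul, hφV]; simp [Pi.single_apply, hb.symm]
      · simp
    have hnn : ∀ k : List G, (∀ b ∈ k, b ∈ B) → ∀ j, 0 ≤ φ k.sum j := by
      intro k
      induction k with
      | nil => simp
      | cons a k ihk =>
        intro hk j
        rw [List.sum_cons, map_add, Pi.add_apply]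
        exact add_nonneg (hB a (hk a (by simp)) j) (ihk (fun b hb => hk b (by simp [hb])) j)
    have hc0 : ∀ j, 0 ≤ c j := by
      intro j
      have := hnn l₂ (fun b hb => hl b (by rw [h]; simp [hb])) j
      rw [hφ] at this
      exact nonneg_of_mul_nonneg_left this (by exact_mod_cast hD)
    refine ⟨t, fun j => m j + (c j).toNat, ht, htB, ?_⟩
    have e1 : l.sum = (l₁ ++ l₃).sum + l₂.sum := by
      rw [h]; simp only [List.sum_append]; abel
    have e2 : ∑ j, (c j).toNat • V j = l₂.sum := by
      rw [← hc]
      refine Finset.sum_congr rfl fun j _ => ?_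
      rw [← natCast_zsmul, Int.toNat_of_nonneg (hc0 j)]
    rw [e1, hsum, ← e2]
    simp only [add_smul, Finset.sum_add_distrib]
    abel
  by_cases hv : ∃ b ∈ l, b ∈ Set.range V
  · obtain ⟨b, hb, hbV⟩ := hv
    obtain ⟨l₁, l₃, h⟩ := List.append_of_mem hb
    exact main l₁ [b] l₃ (by simp [h]) (by simp) (by
      simpa using Submodule.subset_span hbV)
  · by_cases hlen : D ≤ l.length
    · obtain ⟨l₁, l₂, l₃, h, h2, h3⟩ := exists_zero_block _ D hD hcard l hlen
      exact main l₁ l₂ l₃ h h2 h3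
    · refine ⟨l, 0, by omega, fun b hb => ⟨hl b hb, fun h => hv ⟨b, hb, h⟩⟩, by simp⟩

theorem abstract_main (V : ι → G) (D : ℕ) (hD : 0 < D)
    (hcard : Nat.card (G ⧸ Submodule.span ℤ (Set.range V)) = D)
    (φ : G →+ (ι → ℤ)) (hφinj : Function.Injective φ)
    (hφV : ∀ i, φ (V i) = Pi.single i (D : ℤ))
    (B : Set G) (hB : ∀ b ∈ B, ∀ i, 0 ≤ φ b i) (hBs : ∀ b ∈ B, ∑ i, φ b i = D)
    (hVB : ∀ i, V i ∈ B) (p : G) (h : ℕ) (hp : ∑ i, φ p i = D * h) [Nonempty ι]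
    (hh : (Fintype.card ι : ℤ) * (D - 2) ≤ h)
    (hS : ∀ i, ∃ m : ℕ, p + m • V i ∈ AddSubmonoid.closure B) :
    p ∈ AddSubmonoid.closure B := by
  by_contra hcon
  have hb1 : ∀ b ∈ B, b ∉ Set.range V → ∀ i, φ b i ≤ D - 1 := by
    intro b hb hbV i
    by_contra hlt
    push Not at hlt
    have hle : ∀ k, k ≠ i → φ b k = 0 := by
      intro k hk
      have h1 := hBs b hb
      rw [← Finset.add_sum_erase _ _ (Finset.mem_univ i)] at h1
      have h2 := Finset.single_le_sum (f := fun k => φ b k) (s := Finset.univ.erase i)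
        (fun j _ => hB b hb j) (Finset.mem_erase.2 ⟨hk, Finset.mem_univ k⟩)
      have h3 := hB b hb k
      omega
    have h4 : φ b i = D := by
      rw [← hBs b hb, Finset.sum_eq_single i]
      · intro k _ hk; exact hle k hk
      · simp
    apply hbV
    refine ⟨i, hφinj ?_⟩
    rw [hφV]
    ext k
    by_cases hk : k = i
    · subst hk; simp [h4]
    · simp [hk, hle k hk]
  have hlist : ∀ t : List G, (∀ b ∈ t, b ∈ B ∧ b ∉ Set.range V) → ∀ i,
      φ t.sum i ≤ t.length * ((D : ℤ) - 1) := by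
    intro t
    induction t with
    | nil => simp
    | cons a t ih =>
      intro ht i
      have h1 := ih (fun b hb => ht b (by simp [hb])) i
      have h2 := hb1 a (ht a (by simp)).1 (ht a (by simp)).2 i
      rw [List.sum_cons, map_add, Pi.add_apply, List.length_cons]
      push_cast
      linarith
  have hcoord : ∀ i, φ p i ≤ ((D : ℤ) - 1) * (D - 1) - D := by
    intro i
    obtain ⟨m, hm⟩ := hS i
    obtain ⟨l, hl, hls⟩ := AddSubmonoid.exists_list_of_mem_closure hm
    obtain ⟨t, n, ht, htB, hsum⟩ := reduce_list V D hD hcard φ hφV B hB _ l rfl hl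
    rw [hls] at hsum
    have hlt : n i < m := by
      by_contra hge
      push Not at hge
      apply hcon
      have : p = t.sum + ((n i - m) • V i + ∑ j ∈ Finset.univ.erase i, n j • V j) := by
        rw [← Finset.add_sum_erase _ _ (Finset.mem_univ i)] at hsum
        have e : n i • V i = (n i - m) • V i + m • V i := by
          rw [← add_smul, Nat.sub_add_cancel hge]
        rw [e] at hsum
        apply add_right_cancel (b := m • V i)
        rw [hsum]; abel
      rw [this]
      refine add_mem ?_ (add_mem ?_ ?_)
      · exact AddSubmonoid.list_sum_mem _ fun b hb => AddSubmonoid.subset_closure (htB b hb).1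
      · exact nsmul_mem (AddSubmonoid.subset_closure (hVB i)) _
      · exact sum_mem fun j _ => nsmul_mem (AddSubmonoid.subset_closure (hVB j)) _
    have e := congrArg (fun x => φ x i) hsum
    simp only [map_add, map_sum, map_nsmul, hφV, Pi.add_apply, Finset.sum_apply, Pi.smul_apply,
      Pi.single_eq_same] at e
    rw [Finset.sum_eq_single i] at e
    · simp only [Pi.single_eq_same, nsmul_eq_mul] at e
      have h1 := hlist t htB i
      have h2 : (t.length : ℤ) ≤ D - 1 := by omega
      have h3 : (n i : ℤ) + 1 ≤ m := by exact_mod_cast hlt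
      have h4 : (1 : ℤ) ≤ D := by exact_mod_cast hD
      nlinarith
    · intro b _ hb
      simp [Pi.single_apply, hb.symm]
    · simp
  have hsum : ∑ i, φ p i ≤ Fintype.card ι * (((D : ℤ) - 1) * (D - 1) - D) := by
    calc ∑ i, φ p i ≤ ∑ i : ι, (((D : ℤ) - 1) * (D - 1) - D) := Finset.sum_le_sum fun i _ => hcoord i
      _ = _ := by simp; ring
  rw [hp] at hsum
  have hc : (0 : ℤ) < Fintype.card ι := by exact_mod_cast Fintype.card_pos
  have hD1 : (1 : ℤ) ≤ D := by exact_mod_cast hD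
  rcases hD1.eq_or_lt with h1 | h1
  · rw [← h1] at hsum
    have : (0 : ℤ) ≤ h := by positivity
    linarith
  · have := mul_le_mul_of_nonneg_left hh (by linarith : (0 : ℤ) ≤ D)
    nlinarith

end Abstract

theorem det_ne_zero_of_affine (d : ℕ) (v : Fin (d + 1) → Fin d → ℤ)
    (haff : AffineIndependent ℝ (fun i (j : Fin d) => (v i j : ℝ))) :
    (Matrix.of fun r c => liftZ (v c) r).det ≠ 0 := by
  intro h0
  obtain ⟨w, hw, hw0⟩ := Matrix.exists_mulVec_eq_zero_iff.2 h0
  rw [affineIndependent_iff_of_fintype] at haff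
  have hr : ∀ r, ∑ c, liftZ (v c) r * w c = 0 := fun r => congrFun hw0 r
  have hs : ∑ i, (w i : ℝ) = 0 := by
    have := hr (Fin.last d)
    simp only [liftZ, Fin.snoc_last, one_mul] at this
    exact_mod_cast this
  have := haff (fun i => (w i : ℝ)) hs (by
    rw [Finset.weightedVSub_eq_weightedVSubOfPoint_of_sum_eq_zero _ _ _ hs 0]
    simp only [Finset.weightedVSubOfPoint_apply, vsub_eq_sub, sub_zero]
    ext j
    have := hr (Fin.castSucc j)
    simp only [liftZ, Fin.snoc_castSucc] at this
    simp only [Finset.sum_apply, Pi.smul_apply, smul_eq_mul, Pi.zero_apply]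
    have h2 : ∑ i, w i * v i j = 0 := by rw [← this]; simp [mul_comm]
    exact_mod_cast h2)
  apply hw
  ext i
  exact_mod_cast this i

theorem card_quot (n : ℕ) (V : Fin n → Fin n → ℤ)
    (hdet : (Matrix.of fun r c => V c r).det ≠ 0) :
    Nat.card ((Fin n → ℤ) ⧸ Submodule.span ℤ (Set.range V)) =
      (Matrix.of fun r c => V c r).det.natAbs := by
  have hli : LinearIndependent ℤ V :=
    Matrix.linearIndependent_cols_of_det_ne_zero hdet
  rw [← Submodule.natAbs_det_basis_change (Pi.basisFun ℤ (Fin n)) _ (Module.Basis.span hli)]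
  congr 1
  rw [Module.Basis.det_apply]
  congr 1
  ext r c
  simp [Module.Basis.toMatrix_apply, Module.Basis.span_apply]

theorem sum_snoc_last {d : ℕ} (l : List (Fin d → ℤ)) :
    (l.map liftZ).sum = Fin.snoc (α := fun _ => ℤ) l.sum (l.length : ℤ) := by
  induction l with
  | nil =>
    ext r
    refine Fin.lastCases ?_ (fun j => ?_) r <;> simp
  | cons a l ih =>
    rw [List.map_cons, List.sum_cons, ih]
    ext r
    refine Fin.lastCases ?_ (fun j => ?_) r
    · simp [liftZ, add_comm]
    · simp [liftZ]

theorem sumset_structure_simplex (d : ℕ) (hd : 1 ≤ d) (A : Set (Fin d → ℤ))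
    (hfin : A.Finite)
    (hgen : AddSubgroup.closure (A - A) = ⊤)
    (v : Fin (d + 1) → Fin d → ℤ) (hvA : ∀ i, v i ∈ A)
    (haff : AffineIndependent ℝ (fun i (j : Fin d) => (v i j : ℝ)))
    (hhull : ∀ a ∈ A, (fun j => (a j : ℝ)) ∈
      convexHull ℝ (Set.range (fun i (j : Fin d) => (v i j : ℝ))))
    (D : ℕ) (hD : (D : ℤ) = |(Matrix.of fun r c => liftZ (v c) r).det|) :
    ∀ h : ℕ, ((d + 1) * D : ℤ) - 2 - 2 * d ≤ (h : ℤ) →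
      iterSumset A h =
        ⋂ i : Fin (d + 1),
          (fun x => h • v i + x) '' (⋃ k : ℕ, iterSumset ((fun a => a - v i) '' A) k) := by
  intro h hh
  have hsub : ∀ (i : Fin (d + 1)) (l : List (Fin d → ℤ)),
      (l.map (fun a => a - v i)).sum = l.sum - l.length • v i := by
    intro i l
    induction l with
    | nil => simp
    | cons a l ih =>
      rw [List.map_cons, List.sum_cons, ih, List.sum_cons, List.length_cons, add_smul, one_smul]
      abel
  ext x
  simp only [Set.mem_iInter, Set.mem_image, Set.mem_iUnion]
  constructor
  · intro hx i
    obtain ⟨l, hl, hlA, rfl⟩ := (mem_iterSumset_iff _ _ _).1 hx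
    refine ⟨l.sum - h • v i, ⟨h, (mem_iterSumset_iff _ _ _).2
      ⟨l.map (fun a => a - v i), by simp [hl], ?_, ?_⟩⟩, by abel⟩
    · intro b hb
      obtain ⟨a, ha, rfl⟩ := List.mem_map.1 hb
      exact ⟨a, hlA a ha, rfl⟩
    · rw [hsub, hl]
  intro hx
  set M : Matrix (Fin (d + 1)) (Fin (d + 1)) ℤ := Matrix.of fun r c => liftZ (v c) r with hM
  have hdet : M.det ≠ 0 := det_ne_zero_of_affine d v haff
  have hDpos : 0 < D := by
    have : (0 : ℤ) < D := by rw [hD]; exact abs_pos.2 hdet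
    exact_mod_cast this
  set N : Matrix (Fin (d + 1)) (Fin (d + 1)) ℤ := M.det.sign • M.adjugate with hN
  have hsd : M.det.sign * M.det = D := by rw [hD, Int.sign_mul_self_eq_abs]
  have hNM : N * M = (D : ℤ) • (1 : Matrix _ _ ℤ) := by
    rw [hN, Matrix.smul_mul, Matrix.adjugate_mul, smul_smul, hsd]
  have hMN : M * N = (D : ℤ) • (1 : Matrix _ _ ℤ) := by
    rw [hN, Matrix.mul_smul, Matrix.mul_adjugate, smul_smul, hsd]
  set V : Fin (d + 1) → Fin (d + 1) → ℤ := fun c => liftZ (v c) with hV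
  let φ : (Fin (d + 1) → ℤ) →+ (Fin (d + 1) → ℤ) := N.mulVecLin.toAddMonoidHom
  have hφ : ∀ w, φ w = N.mulVec w := fun w => rfl
  have hMφ : ∀ w, M.mulVec (φ w) = (D : ℤ) • w := by
    intro w
    rw [hφ, Matrix.mulVec_mulVec, hMN, Matrix.smul_mulVec, Matrix.one_mulVec]
  have hφinj : Function.Injective φ := by
    intro a b hab
    have h1 := hMφ a
    rw [hab, hMφ b] at h1
    ext r
    have h2 := congrFun h1 r
    simp only [Pi.smul_apply, smul_eq_mul] at h2
    exact (mul_left_cancel₀ (by exact_mod_cast hDpos.ne') h2).symm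
  have hφV : ∀ i, φ (V i) = Pi.single i (D : ℤ) := by
    intro i
    have h1 : V i = M.mulVec (Pi.single i 1) := by
      ext r
      simp [hM, hV]
    rw [h1, hφ, Matrix.mulVec_mulVec, hNM, Matrix.smul_mulVec, Matrix.one_mulVec]
    ext k
    simp [Pi.single_apply]
  have hφsum : ∀ w, ∑ i, φ w i = D * w (Fin.last d) := by
    intro w
    have h1 := congrFun (hMφ w) (Fin.last d)
    simp only [Matrix.mulVec, dotProduct, hM, Matrix.of_apply, liftZ, Fin.snoc_last, one_mul,
      Pi.smul_apply, smul_eq_mul] at h1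
    exact h1
  have hφlift : ∀ (a : Fin d → ℤ) i, φ (liftZ a) i =
      ∑ j, N i (Fin.castSucc j) * a j + N i (Fin.last d) := by
    intro a i
    rw [hφ, Matrix.mulVec, dotProduct, Fin.sum_univ_castSucc]
    simp [liftZ]
  have hφnn : ∀ a ∈ A, ∀ i, 0 ≤ φ (liftZ a) i := by
    intro a ha i
    have hconv : Convex ℝ {y : Fin d → ℝ | -(N i (Fin.last d) : ℝ) ≤
        ∑ j, (N i (Fin.castSucc j) : ℝ) * y j} := by
      refine convex_halfSpace_ge ⟨?_, ?_⟩ _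
      · intro x y
        simp [mul_add, Finset.sum_add_distrib]
      · intro c x
        simp only [Pi.smul_apply, smul_eq_mul, Finset.mul_sum]
        exact Finset.sum_congr rfl fun j _ => by ring
    have hmem := convexHull_min (s := Set.range (fun i (j : Fin d) => (v i j : ℝ))) (by
      rintro _ ⟨c, rfl⟩
      have h1 : 0 ≤ φ (liftZ (v c)) i := by
        have := hφV c
        rw [hV] at this
        simp only at this
        rw [this, Pi.single_apply]
        split_ifs <;> positivity
      rw [hφlift] at h1
      have h2 : (0 : ℝ) ≤ ∑ j, (N i (Fin.castSucc j) : ℝ) * v c j + N i (Fin.last d) := by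
        exact_mod_cast h1
      simp only [Set.mem_ofPred_eq]
      linarith) hconv (hhull a ha)
    simp only [Set.mem_ofPred_eq] at hmem
    rw [hφlift]
    have h2 : (0 : ℝ) ≤ ∑ j, (N i (Fin.castSucc j) : ℝ) * a j + N i (Fin.last d) := by
      linarith
    exact_mod_cast h2
  have hcard : Nat.card ((Fin (d + 1) → ℤ) ⧸ Submodule.span ℤ (Set.range V)) = D := by
    rw [card_quot (d + 1) V hdet]
    have : (M.det.natAbs : ℤ) = D := by rw [hD, Int.natCast_natAbs]
    exact_mod_cast this
  have hmain := abstract_main V D hDpos hcard φ hφinj hφV (liftZ '' A)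
    (by rintro _ ⟨a, ha, rfl⟩; exact hφnn a ha)
    (by rintro _ ⟨a, ha, rfl⟩; rw [hφsum]; simp [liftZ])
    (fun i => ⟨v i, hvA i, rfl⟩)
    (Fin.snoc (α := fun _ => ℤ) x (h : ℤ)) h (by rw [hφsum]; simp)
    (by simp only [Fintype.card_fin]; push_cast; linarith)
    (by
      intro i
      obtain ⟨y, ⟨k, hy⟩, hxy⟩ := hx i
      obtain ⟨l, hl, hlA, hls⟩ := (mem_iterSumset_iff _ _ _).1 hy
      obtain ⟨l', rfl, hl'⟩ : ∃ l' : List (Fin d → ℤ), l'.map (fun a => a - v i) = l ∧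
          ∀ a ∈ l', a ∈ A := by
        refine ⟨l.map (fun a => a + v i), by simp [Function.comp_def], ?_⟩
        intro a ha
        obtain ⟨b, hb, rfl⟩ := List.mem_map.1 ha
        obtain ⟨c, hc, hcb⟩ := hlA b hb
        simp only at hcb
        rw [← hcb]; simpa using hc
      rw [List.length_map] at hl
      rw [hsub, hl] at hls
      refine ⟨k, ?_⟩
      have : (Fin.snoc (α := fun _ => ℤ) x (h : ℤ) : Fin (d + 1) → ℤ) + k • V i =
          (l'.map liftZ).sum + h • V i := by
        rw [sum_snoc_last, ← hxy, ← hls, hl]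
        ext r
        refine Fin.lastCases ?_ (fun j => ?_) r
        · simp [hV, liftZ, add_comm]
        · simp [hV, liftZ]; ring
      rw [this]
      refine add_mem (AddSubmonoid.list_sum_mem _ ?_)
        (nsmul_mem (AddSubmonoid.subset_closure (Set.mem_image_of_mem liftZ (hvA i))) _)
      intro b hb
      obtain ⟨a, ha, rfl⟩ := List.mem_map.1 hb
      exact AddSubmonoid.subset_closure ⟨a, hl' a ha, rfl⟩)
  obtain ⟨l, hl, hls⟩ := AddSubmonoid.exists_list_of_mem_closure hmain
  obtain ⟨l', rfl, hl'⟩ : ∃ l' : List (Fin d → ℤ), l'.map liftZ = l ∧ ∀ a ∈ l', a ∈ A := by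
    clear hls
    induction l with
    | nil => exact ⟨[], rfl, by simp⟩
    | cons b l ih =>
      obtain ⟨l', h1, h2⟩ := ih (fun y hy => hl y (by simp [hy]))
      obtain ⟨a, ha, hab⟩ := hl b (by simp)
      refine ⟨a :: l', by simp [h1, hab], ?_⟩
      intro c hc
      rcases List.mem_cons.1 hc with rfl | hc
      · exact ha
      · exact h2 c hc
  rw [sum_snoc_last] at hls
  refine (mem_iterSumset_iff _ _ _).2 ⟨l', ?_, hl', ?_⟩
  · have := congrFun hls (Fin.last d)
    simp only [Fin.snoc_last] at this
    exact_mod_cast this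
  · ext j
    have := congrFun hls (Fin.castSucc j)
    simpa only [Fin.snoc_castSucc] using this
end

section
/- Let d ≥ 1, let A ⊆ ℤ^d be finite with A − A generating ℤ^d as an additive group, and suppose v_1, …, v_{d+1} ∈ A are affinely independent over ℝ and A is contained in the convex hull of {v_1, …, v_{d+1}}. Then there exists a polynomial p ∈ ℚ[x] such that |hA| = p(h) for every natural number h satisfying h ≥ (d+1)·D − 1 − 3d (as integers). -/
open Pointwise

/-- points counted by the counting lemma -/
def cntSet {d : ℕ} (s h : ℕ) (Q : (Fin (d+1) → ℕ) → Prop) : Set (Fin (d+1) → ℕ) :=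
  {n | s + ∑ i, n i = h ∧ Q n}

theorem cntSet_finite {d : ℕ} (s h : ℕ) (Q : (Fin (d+1) → ℕ) → Prop) : (cntSet s h Q).Finite := by
  apply (Set.finite_Iic (fun _ : Fin (d+1) => h)).subset
  rintro n ⟨h1, -⟩ i
  have := Finset.single_le_sum (f := n) (fun _ _ => Nat.zero_le _) (Finset.mem_univ i)
  simp only; omega

theorem stars_bars (d m : ℕ) :
    ({n : Fin (d+1) → ℕ | ∑ i, n i = m}).ncard = (m + d).choose d := by
  have h := Finset.card_finsuppAntidiag_nat_eq_multichoose (s := (Finset.univ : Finset (Fin (d+1)))) m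
  rw [Nat.multichoose_eq] at h
  simp only [Finset.card_univ, Fintype.card_fin] at h
  rw [show d + 1 + m - 1 = d + m by omega, Nat.choose_symm_add.symm] at h
  rw [add_comm m d, ← h, ← Set.ncard_coe_finset]
  symm
  apply Set.ncard_congr (fun (f : Fin (d+1) →₀ ℕ) _ => (f : Fin (d+1) → ℕ))
  · intro f hf
    simpa using hf
  · intro f g _ _ h
    exact DFunLike.coe_injective h
  · intro n hn
    refine ⟨Finsupp.equivFunOnFinite.symm n, ?_, ?_⟩
    · simpa using hn
    · simp

theorem cnt_single {d : ℕ} (s h : ℕ) (y : Fin (d+1) → ℕ) (hh : s + ∑ i, y i ≤ h + d) :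
    (cntSet s h (fun n => y ≤ n)).ncard = (h + d - (s + ∑ i, y i)).choose d := by
  by_cases hlt : h < s + ∑ i, y i
  · rw [Nat.choose_eq_zero_of_lt (by omega)]
    convert Set.ncard_empty (Fin (d+1) → ℕ)
    ext n
    simp only [cntSet, Set.mem_ofPred_eq, Set.mem_empty_iff_false, iff_false, not_and]
    intro h1 h2
    have := Finset.sum_le_sum (s := Finset.univ) (fun i _ => h2 i)
    omega
  · push Not at hlt
    rw [show h + d - (s + ∑ i, y i) = (h - (s + ∑ i, y i)) + d by omega, ← stars_bars]
    symm
    apply Set.ncard_congr (fun n _ => n + y)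
    · intro n hn
      simp only [Set.mem_ofPred_eq] at hn
      refine ⟨?_, ?_⟩
      · simp only [Pi.add_apply, Finset.sum_add_distrib]; omega
      · intro i; simp
    · intro a b _ _ h; simpa using h
    · rintro n ⟨h1, h2⟩
      have h3 : n - y + y = n := tsub_add_cancel_of_le h2
      refine ⟨n - y, ?_, h3⟩
      have : ∑ i, n i = ∑ i, (n-y) i + ∑ i, y i := by
        rw [← Finset.sum_add_distrib]; exact Finset.sum_congr rfl (fun i _ => (congrFun h3 i).symm)
      simp only [Set.mem_ofPred_eq]
      omega

theorem choose_poly (d k : ℕ) : ∃ p : Polynomial ℚ, ∀ h : ℕ, k ≤ h + d →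
    ((h + d - k).choose d : ℚ) = p.eval (h : ℚ) := by
  refine ⟨(Polynomial.C ((d.factorial : ℚ)⁻¹) * (descPochhammer ℚ d)).comp
    (Polynomial.X + Polynomial.C ((d : ℚ) - k)), fun h hh => ?_⟩
  have : (h : ℚ) + ((d : ℚ) - k) = ((h + d - k : ℕ) : ℚ) := by
    rw [Nat.cast_sub hh]; push_cast; ring
  simp only [Polynomial.eval_comp, Polynomial.eval_mul, Polynomial.eval_C, Polynomial.eval_add,
    Polynomial.eval_X]
  rw [this, descPochhammer_eval_eq_descFactorial, Nat.descFactorial_eq_factorial_mul_choose]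
  have := Nat.factorial_ne_zero d
  push_cast
  field_simp

theorem cnt_list {d : ℕ} (s : ℕ) (B : Fin (d+1) → ℕ) (k : ℕ) : ∀ (Y : List (Fin (d+1) → ℕ)),
    Y.length = k → (∀ y ∈ Y, y ≤ B) →
    ∃ p : Polynomial ℚ, ∀ h : ℕ, s + ∑ i, B i ≤ h + d →
      ((cntSet s h (fun n => ∃ y ∈ Y, y ≤ n)).ncard : ℚ) = p.eval (h : ℚ) := by
  induction k with
  | zero =>
    intro Y hY _
    rw [List.length_eq_zero_iff] at hY
    subst hY
    refine ⟨0, fun h _ => ?_⟩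
    simp [cntSet]
  | succ k ih =>
    intro Y hY hB
    obtain _ | ⟨y, L⟩ := Y
    · simp at hY
    obtain ⟨p1, hp1⟩ := ih L (by simpa using hY) (fun z hz => hB z (by simp [hz]))
    obtain ⟨p2, hp2⟩ := ih (L.map (fun z => y ⊔ z)) (by simpa using hY) (by
      intro z hz
      simp only [List.mem_map] at hz
      obtain ⟨w, hw, rfl⟩ := hz
      exact sup_le (hB y (by simp)) (hB w (by simp [hw])))
    obtain ⟨p3, hp3⟩ := choose_poly d (s + ∑ i, y i)
    refine ⟨p1 + p3 - p2, fun h hh => ?_⟩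
    have hy : s + ∑ i, y i ≤ h + d := by
      have := Finset.sum_le_sum (s := Finset.univ) (fun i _ => hB y (by simp) i)
      omega
    rw [Polynomial.eval_sub, Polynomial.eval_add, ← hp1 h hh, ← hp2 h hh, ← hp3 h hy,
      ← cnt_single s h y hy]
    have e1 : cntSet s h (fun n => ∃ z ∈ y :: L, z ≤ n) =
        cntSet s h (fun n => ∃ z ∈ L, z ≤ n) ∪ cntSet s h (fun n => y ≤ n) := by
      ext n
      simp only [cntSet, List.mem_cons, exists_eq_or_imp, Set.mem_ofPred_eq, Set.mem_union]
      generalize (∃ a ∈ L, a ≤ n) = q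
      tauto
    have e2 : cntSet s h (fun n => ∃ z ∈ L.map (fun z => y ⊔ z), z ≤ n) =
        cntSet s h (fun n => ∃ z ∈ L, z ≤ n) ∩ cntSet s h (fun n => y ≤ n) := by
      ext n
      simp only [cntSet, List.mem_map, exists_exists_and_eq_and, sup_le_iff, Set.mem_ofPred_eq,
        Set.mem_inter_iff]
      constructor
      · rintro ⟨h1, z, hz, h2, h3⟩; exact ⟨⟨h1, z, hz, h3⟩, h1, h2⟩
      · rintro ⟨⟨h1, z, hz, h3⟩, -, h2⟩; exact ⟨h1, z, hz, h2, h3⟩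
    have := Set.ncard_union_add_ncard_inter (cntSet s h (fun n => ∃ z ∈ L, z ≤ n))
      (cntSet s h (fun n => y ≤ n)) (cntSet_finite _ _ _) (cntSet_finite _ _ _)
    rw [e1, e2, eq_sub_iff_add_eq]
    exact_mod_cast this

/-- pigeonhole -/
theorem zero_sum {G : Type*} [AddCommGroup G] (H : AddSubgroup G) [Finite H] (l : List G)
    (hl : ∀ a ∈ l, a ∈ H) (hc : Nat.card H ≤ l.length) :
    ∃ l1 l2 l3, l = l1 ++ l2 ++ l3 ∧ l2 ≠ [] ∧ l2.sum = 0 := by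
  classical
  have := Fintype.ofFinite H
  let f : Fin (l.length + 1) → H := fun j => ⟨(l.take j).sum, by
    apply AddSubgroup.list_sum_mem
    intro x hx
    exact hl x (List.mem_of_mem_take hx)⟩
  obtain ⟨i, j, hij, hf⟩ := Fintype.exists_ne_map_eq_of_card_lt f (by
    rw [← Nat.card_eq_fintype_card, Fintype.card_fin]; omega)
  wlog hlt : i < j generalizing i j
  · exact this j i hij.symm hf.symm (lt_of_le_of_ne (not_lt.mp hlt) hij.symm)
  have hf' : (l.take i).sum = (l.take j).sum := congrArg Subtype.val hf
  have hlt' : (i : ℕ) < j := hlt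
  have e : l.take j = l.take i ++ (l.take j).drop i := by
    conv_lhs => rw [← List.take_append_drop i (l.take j)]
    rw [List.take_take, min_eq_left hlt'.le]
  refine ⟨l.take i, (l.take j).drop i, l.drop j, ?_, ?_, ?_⟩
  · rw [← e, List.take_append_drop]
  · intro h0
    have := congrArg List.length h0
    simp at this
    omega
  · rw [e, List.sum_append] at hf'
    simpa using hf'

/-- reduction mod D as an additive hom -/
def castZ (d D : ℕ) : (Fin (d+1) → ℕ) →+ (Fin (d+1) → ZMod D) where
  toFun a i := (a i : ZMod D)
  map_zero' := by ext; simp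
  map_add' a b := by ext; simp

@[simp] theorem castZ_apply (d D : ℕ) (a : Fin (d+1) → ℕ) (i) : castZ d D a i = (a i : ZMod D) := rfl

theorem castZ_eq_zero {d D : ℕ} {a : Fin (d+1) → ℕ} (h : castZ d D a = 0) :
    ∃ c : Fin (d+1) → ℕ, a = D • c := by
  have : ∀ i, D ∣ a i := fun i => by
    have := congrFun h i
    simpa [ZMod.natCast_eq_zero_iff] using this
  choose c hc using this
  exact ⟨c, by ext i; simp [hc i]⟩

theorem reduce_list_s5 {d D : ℕ} (P : Set (Fin (d+1) → ℕ))
    (H : AddSubgroup (Fin (d+1) → ZMod D)) [Finite H] (hH : Nat.card H ≤ D)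
    (hPH : ∀ a ∈ P, castZ d D a ∈ H) (k : ℕ) : ∀ (l : List (Fin (d+1) → ℕ)), l.length ≤ k →
    (∀ a ∈ l, a ∈ P) →
    ∃ (c : Fin (d+1) → ℕ) (l' : List (Fin (d+1) → ℕ)), (∀ a ∈ l', a ∈ P) ∧ l'.length < D ∧
      l.sum = D • c + l'.sum := by
  have hD : 0 < D := lt_of_lt_of_le Nat.card_pos hH
  induction k with
  | zero =>
    intro l hl hP
    exact ⟨0, l, hP, by omega, by simp⟩
  | succ k ih =>
    intro l hl hP
    by_cases hlt : l.length < D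
    · exact ⟨0, l, hP, hlt, by simp⟩
    push Not at hlt
    obtain ⟨m1, m2, m3, h1, h2, h3⟩ := zero_sum H (l.map (castZ d D)) (by
      intro a ha
      simp only [List.mem_map] at ha
      obtain ⟨b, hb, rfl⟩ := ha
      exact hPH b (hP b hb)) (by simpa using hH.trans hlt)
    obtain ⟨l12, l3, rfl, h4, rfl⟩ := List.map_eq_append_iff.1 h1
    obtain ⟨l1, l2, rfl, rfl, rfl⟩ := List.map_eq_append_iff.1 h4
    rw [← map_list_sum] at h3
    obtain ⟨c, hc⟩ := castZ_eq_zero h3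
    have h2' : l2 ≠ [] := by simpa using h2
    have := List.length_pos_iff.2 h2'
    obtain ⟨c', l', hl', h5, h6⟩ := ih (l1 ++ l3) (by simp at hl ⊢; omega) (by
      intro a ha
      apply hP a
      simp at ha ⊢
      tauto)
    refine ⟨c + c', l', hl', h5, ?_⟩
    simp only [List.sum_append] at h6 ⊢
    rw [smul_add, add_assoc (D • c), ← h6, ← hc]
    abel

/-- The minimal generators in residue class `r` -/
def genY {d : ℕ} (D : ℕ) (P : Set (Fin (d+1) → ℕ)) (r : Fin (d+1) → ℕ) : Set (Fin (d+1) → ℕ) :=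
  {n | ∃ l : List (Fin (d+1) → ℕ), (∀ a ∈ l, a ∈ P) ∧ l.length < D ∧ r + D • n = l.sum}

/-- The whole monoid -/
def monT {d : ℕ} (D : ℕ) (P : Set (Fin (d+1) → ℕ)) : Set (Fin (d+1) → ℕ) :=
  {x | ∃ (c : Fin (d+1) → ℕ) (l : List (Fin (d+1) → ℕ)), (∀ a ∈ l, a ∈ P) ∧ x = D • c + l.sum}

theorem list_sum_apply_le {d D : ℕ} (l : List (Fin (d+1) → ℕ)) (i) (h : ∀ a ∈ l, a i < D) :
    l.sum i ≤ l.length * (D - 1) := by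
  induction l with
  | nil => simp
  | cons a l ih =>
    have := ih (fun b hb => h b (by simp [hb]))
    have := h a (by simp)
    simp only [List.sum_cons, Pi.add_apply, List.length_cons, add_mul]
    omega

theorem mem_monT_iff {d D : ℕ} (P : Set (Fin (d+1) → ℕ))
    (H : AddSubgroup (Fin (d+1) → ZMod D)) [Finite H] (hH : Nat.card H ≤ D)
    (hPH : ∀ a ∈ P, castZ d D a ∈ H) (r n : Fin (d+1) → ℕ) (hr : ∀ i, r i < D) :
    r + D • n ∈ monT D P ↔ ∃ y ∈ genY D P r, y ≤ n := by
  constructor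
  · rintro ⟨c, l, hl, h⟩
    obtain ⟨c', l', hl', h1, h2⟩ := reduce_list_s5 P H hH hPH _ l le_rfl hl
    rw [h2, ← add_assoc, ← smul_add] at h
    have hle : c + c' ≤ n := by
      intro i
      have h3 := congrFun h i
      have := hr i
      simp only [Pi.add_apply, Pi.smul_apply, smul_eq_mul] at h3 ⊢
      by_contra hcon
      push Not at hcon
      have : D * (n i + 1) ≤ D * (c i + c' i) := Nat.mul_le_mul_left _ hcon
      rw [mul_add, mul_one] at this
      omega
    refine ⟨n - (c + c'), ⟨l', hl', h1, ?_⟩, tsub_le_self⟩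
    have h4 : n = (c + c') + (n - (c + c')) := (add_tsub_cancel_of_le hle).symm
    rw [h4, smul_add, add_left_comm] at h
    exact add_left_cancel h
  · rintro ⟨y, ⟨l, hl, h1, h2⟩, hy⟩
    refine ⟨n - y, l, hl, ?_⟩
    rw [← h2, add_left_comm, ← smul_add, tsub_add_cancel_of_le hy]

theorem genY_finite {d D : ℕ} (P : Set (Fin (d+1) → ℕ)) (hP : ∀ a ∈ P, ∀ i, a i < D)
    (r : Fin (d+1) → ℕ) : (genY D P r).Finite := by
  apply (Set.finite_Iic (fun _ : Fin (d+1) => D * (D - 1))).subset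
  rintro n ⟨l, hl, h1, h2⟩ i
  have h3 := list_sum_apply_le l i (fun a ha => hP a (hl a ha) i)
  have h4 := congrFun h2 i
  simp only [Pi.add_apply, Pi.smul_apply, smul_eq_mul] at h4 ⊢
  have : l.length * (D - 1) ≤ D * (D - 1) := Nat.mul_le_mul_right _ h1.le
  have : n i ≤ D * n i := Nat.le_mul_of_pos_left _ (by omega)
  omega

theorem extremal {d D : ℕ} (hD2 : 2 ≤ D) (l : List (Fin (d+1) → ℕ)) (i) (h : ∀ a ∈ l, a i < D)
    (hl : l.length < D) : l.sum i ≤ D * (D - 2) ∨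
      (l.sum i = D * (D-2) + 1 ∧ ∃ a ∈ l, a i = D - 1) := by
  have h0 := list_sum_apply_le l i h
  obtain ⟨e, rfl⟩ : ∃ e, D = e + 2 := ⟨D - 2, by omega⟩
  have e1 : e + 2 - 1 = e + 1 := by omega
  have e2 : e + 2 - 2 = e := by omega
  rw [e1] at h0 ⊢
  rw [e2]
  have hle : l.length * (e+1) ≤ (e+1) * (e+1) := Nat.mul_le_mul_right _ (by omega)
  by_cases hx : l.sum i ≤ (e+2) * e
  · exact Or.inl hx
  right
  refine ⟨by nlinarith, ?_⟩
  by_contra hcon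
  push Not at hcon
  have h5 := list_sum_apply_le (D := e+1) l i (fun a ha => by
    have := hcon a ha
    have := h a ha
    omega)
  simp only [Nat.add_sub_cancel] at h5
  have : l.length * e ≤ (e+1)*e := Nat.mul_le_mul_right _ (by omega)
  nlinarith

theorem bound_sum {d D : ℕ} (P : Set (Fin (d+1) → ℕ)) (hP : ∀ a ∈ P, ∀ i, a i < D)
    (hPs : ∀ a ∈ P, ∑ i, a i = D)
    (H : AddSubgroup (Fin (d+1) → ZMod D)) [Finite H] (hH : Nat.card H ≤ D)
    (hPH : ∀ a ∈ P, castZ d D a ∈ H) (hD2 : 2 ≤ D) (r B : Fin (d+1) → ℕ)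
    (hB : ∀ i, ∃ y ∈ genY D P r, y i = B i) :
    ∑ i, (r i + D * B i) ≤ D * ((d+1) * (D-2) + 1) := by
  classical
  have : NeZero D := ⟨by omega⟩
  have key : ∀ i, r i + D * B i ≤ D * (D-2) ∨ (r i + D * B i = D * (D-2) + 1 ∧
      ∃ a ∈ P, a i = D - 1 ∧ castZ d D a + castZ d D r = 0) := by
    intro i
    obtain ⟨y, ⟨l, hl, h1, h2⟩, hy⟩ := hB i
    have e : r i + D * B i = l.sum i := by rw [← h2, ← hy]; simp
    rw [e]
    rcases extremal hD2 l i (fun a ha => hP a (hl a ha) i) h1 with h | ⟨h, a, ha, hai⟩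
    · exact Or.inl h
    refine Or.inr ⟨h, a, hl a ha, hai, ?_⟩
    have hrl : castZ d D r = castZ d D l.sum := by
      rw [← h2]; ext j; simp
    have hrH : castZ d D r ∈ H := by
      rw [hrl, map_list_sum]
      apply AddSubgroup.list_sum_mem
      intro x hx
      simp only [List.mem_map] at hx
      obtain ⟨b, hb, rfl⟩ := hx
      exact hPH b (hl b hb)
    have haH := hPH a (hl a ha)
    have hai' : castZ d D a i = -1 := by
      rw [castZ_apply, hai, Nat.cast_sub (by omega)]; simp
    have hri : castZ d D r i = 1 := by
      rw [hrl, castZ_apply, h]; simp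
    -- projection is bijective
    let f : H → ZMod D := fun x => x.1 i
    have hsurj : Function.Surjective f := by
      intro z
      refine ⟨⟨z.val • castZ d D r, H.nsmul_mem hrH _⟩, ?_⟩
      show (z.val • castZ d D r) i = z
      rw [Pi.smul_apply, hri]
      simp
    have hinj : Function.Injective f :=
      (hsurj.bijective_of_nat_card_le (by simpa using hH)).1
    have := @hinj ⟨_, H.add_mem haH hrH⟩ 0 (by simp only [f, Pi.add_apply, hai', hri]; simp)
    exact congrArg Subtype.val this
  set I := Finset.univ.filter (fun i => ¬ r i + D * B i ≤ D * (D-2)) with hI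
  have hIc : I.card ≤ D := by
    rcases I.eq_empty_or_nonempty with h0 | ⟨i0, hi0⟩
    · simp [h0]
    obtain ⟨-, a, haP, -, ha⟩ := (key i0).resolve_left (Finset.mem_filter.1 hi0).2
    have hall : ∀ i ∈ I, a i = D - 1 := by
      intro i hi
      obtain ⟨-, b, hbP, hbi, hb⟩ := (key i).resolve_left (Finset.mem_filter.1 hi).2
      have h1 : castZ d D a = castZ d D b := add_right_cancel (ha.trans hb.symm)
      have h2 := congrFun h1 i
      simp only [castZ_apply] at h2
      rw [ZMod.natCast_eq_natCast_iff'] at h2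
      rw [Nat.mod_eq_of_lt (hP a haP i), Nat.mod_eq_of_lt (hP b hbP i)] at h2
      omega
    have h3 : ∑ i ∈ I, a i ≤ ∑ i, a i := Finset.sum_le_sum_of_subset (Finset.subset_univ _)
    rw [hPs a haP, Finset.sum_congr rfl hall, Finset.sum_const, smul_eq_mul] at h3
    have : I.card * 1 ≤ I.card * (D - 1) := Nat.mul_le_mul_left _ (by omega)
    omega
  calc ∑ i, (r i + D * B i) ≤ ∑ i, (D * (D-2) + if ¬ r i + D * B i ≤ D * (D-2) then 1 else 0) := by
        apply Finset.sum_le_sum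
        intro i _
        split_ifs with h
        · rcases key i with h' | h'
          · omega
          · omega
        · rcases key i with h' | h'
          · omega
          · omega
    _ = (d+1) * (D * (D-2)) + I.card := by
        rw [Finset.sum_add_distrib, Finset.sum_const, Finset.card_univ, Fintype.card_fin,
          smul_eq_mul, hI, Finset.card_filter]
    _ ≤ _ := by
        have : D * ((d+1) * (D-2) + 1) = (d+1) * (D * (D-2)) + D := by ring
        omega

theorem per_class {d D : ℕ} (P : Set (Fin (d+1) → ℕ)) (hP : ∀ a ∈ P, ∀ i, a i < D)
    (hPs : ∀ a ∈ P, ∑ i, a i = D)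
    (H : AddSubgroup (Fin (d+1) → ZMod D)) [Finite H] (hH : Nat.card H ≤ D)
    (hPH : ∀ a ∈ P, castZ d D a ∈ H) (r : Fin (d+1) → ℕ) (hr : ∀ i, r i < D) :
    ∃ p : Polynomial ℚ, ∀ h : ℕ, ((d + 1) * D : ℤ) - 1 - 3 * d ≤ (h : ℤ) →
      (({n : Fin (d+1) → ℕ | r + D • n ∈ monT D P ∧ ∑ i, (r + D • n) i = D * h}).ncard : ℚ)
        = p.eval (h : ℚ) := by
  classical
  have hD : 0 < D := lt_of_lt_of_le Nat.card_pos hH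
  have hsum : ∀ n : Fin (d+1) → ℕ, ∑ i, (r + D • n) i = ∑ i, r i + D * ∑ i, n i := by
    intro n
    simp [Finset.sum_add_distrib, Finset.mul_sum]
  by_cases hdiv : D ∣ ∑ i, r i
  swap
  · refine ⟨0, fun h _ => ?_⟩
    have : {n : Fin (d+1) → ℕ | r + D • n ∈ monT D P ∧ ∑ i, (r + D • n) i = D * h} = ∅ := by
      ext n
      simp only [Set.mem_ofPred_eq, Set.mem_empty_iff_false, iff_false, not_and]
      intro _ h2
      rw [hsum] at h2
      exact hdiv ((Nat.dvd_add_left (Dvd.intro _ rfl)).1 (h2 ▸ Dvd.intro _ rfl))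
    rw [this]; simp
  obtain ⟨s, hs⟩ := hdiv
  have hset : ∀ h, {n : Fin (d+1) → ℕ | r + D • n ∈ monT D P ∧ ∑ i, (r + D • n) i = D * h} =
      cntSet s h (fun n => ∃ y ∈ (genY_finite P hP r).toFinset.toList, y ≤ n) := by
    intro h
    ext n
    simp only [Set.mem_ofPred_eq, cntSet]
    rw [mem_monT_iff P H hH hPH r n hr, hsum, hs, ← mul_add, and_comm]
    simp [hD.ne']
  simp_rw [hset]
  by_cases hne : (genY_finite P hP r).toFinset.Nonempty
  swap
  · rw [Finset.not_nonempty_iff_eq_empty] at hne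
    rw [hne]
    exact ⟨0, by simp [cntSet]⟩
  let B : Fin (d+1) → ℕ := fun i => (genY_finite P hP r).toFinset.sup (fun y => y i)
  have hB : ∀ i, ∃ y ∈ genY D P r, y i = B i := by
    intro i
    obtain ⟨y, hy, hy'⟩ := Finset.exists_mem_eq_sup _ hne (fun y => y i)
    exact ⟨y, by simpa using hy, hy'.symm⟩
  obtain ⟨p, hp⟩ := cnt_list s B _ (genY_finite P hP r).toFinset.toList rfl (by
    intro y hy i
    rw [Finset.mem_toList] at hy
    exact Finset.le_sup (f := fun y : Fin (d+1) → ℕ => y i) hy)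
  refine ⟨p, fun h hh => hp h ?_⟩
  have hrB : ∑ i, (r i + D * B i) = D * (s + ∑ i, B i) := by
    rw [Finset.sum_add_distrib, hs, mul_add, Finset.mul_sum]
  by_cases hD2 : 2 ≤ D
  · have := bound_sum P hP hPs H hH hPH hD2 r B hB
    rw [hrB] at this
    have := Nat.le_of_mul_le_mul_left this hD
    obtain ⟨e, rfl⟩ : ∃ e, D = e + 2 := ⟨D - 2, by omega⟩
    rw [Nat.add_sub_cancel] at this
    zify at this ⊢
    push_cast at hh
    linarith
  · obtain rfl : D = 1 := by omega
    have h0 : ∑ i, (r i + 1 * B i) = 0 := by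
      apply Finset.sum_eq_zero
      intro i _
      obtain ⟨y, ⟨l, hl, h1, h2⟩, hy⟩ := hB i
      obtain rfl : l = [] := List.length_eq_zero_iff.1 (by omega)
      have := congrFun h2 i
      simpa [← hy] using this
    rw [hrB] at h0
    omega

theorem abstract_main_s5 {d D : ℕ} (P : Set (Fin (d+1) → ℕ)) (hP : ∀ a ∈ P, ∀ i, a i < D)
    (hPs : ∀ a ∈ P, ∑ i, a i = D)
    (H : AddSubgroup (Fin (d+1) → ZMod D)) [Finite H] (hH : Nat.card H ≤ D)
    (hPH : ∀ a ∈ P, castZ d D a ∈ H) :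
    ∃ p : Polynomial ℚ, ∀ h : ℕ, ((d + 1) * D : ℤ) - 1 - 3 * d ≤ (h : ℤ) →
      (({x : Fin (d+1) → ℕ | x ∈ monT D P ∧ ∑ i, x i = D * h}).ncard : ℚ) = p.eval (h : ℚ) := by
  classical
  have hD : 0 < D := lt_of_lt_of_le Nat.card_pos hH
  let R : Finset (Fin (d+1) → ℕ) := Fintype.piFinset (fun _ => Finset.range D)
  have hR : ∀ r : Fin (d+1) → ℕ, r ∈ R ↔ ∀ i, r i < D := by intro r; simp [R]
  have key := fun r : R => per_class P hP hPs H hH hPH r.1 ((hR _).1 r.2)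
  choose p hp using key
  refine ⟨∑ r, p r, fun h hh => ?_⟩
  rw [Polynomial.eval_finsetSum]
  simp_rw [← hp _ h hh]
  have hfin : {x : Fin (d+1) → ℕ | x ∈ monT D P ∧ ∑ i, x i = D * h}.Finite := by
    apply (Set.finite_Iic (fun _ : Fin (d+1) => D * h)).subset
    rintro n ⟨-, h1⟩ i
    have := Finset.single_le_sum (f := n) (fun _ _ => Nat.zero_le _) (Finset.mem_univ i)
    simp only; omega
  rw [Set.ncard_eq_toFinset_card _ hfin]
  rw [Finset.card_eq_sum_card_fiberwise (f := fun x i => x i % D) (t := R) (by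
    intro x _
    simp only [Finset.mem_coe, hR]
    intro i; exact Nat.mod_lt _ hD)]
  rw [← Finset.sum_coe_sort R]
  push_cast
  apply Finset.sum_congr rfl
  rintro ⟨r, hr⟩ _
  rw [hR] at hr
  rw [← Set.ncard_coe_finset]
  refine congrArg Nat.cast ?_
  symm
  apply Set.ncard_congr (fun n _ => r + D • n)
  · rintro n ⟨h1, h2⟩
    simp only [Finset.coe_filter, Set.Finite.mem_toFinset, Set.mem_ofPred_eq]
    refine ⟨⟨h1, h2⟩, ?_⟩
    ext i
    simp [Nat.mod_eq_of_lt (hr i)]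
  · intro a b _ _ hab
    ext i
    have := congrFun hab i
    simpa [hD.ne'] using this
  · intro x hx
    simp only [Finset.coe_filter, Set.Finite.mem_toFinset, Set.mem_ofPred_eq] at hx
    have : r + D • (fun i => x i / D) = x := by
      ext i
      rw [← hx.2]
      simp [Nat.mod_add_div]
    refine ⟨fun i => x i / D, ?_, this⟩
    simp only [Set.mem_ofPred_eq]
    rw [this]
    exact hx.1

theorem snoc_add_one {d : ℕ} (a w : Fin d → ℤ) (h : ℕ) :
    (Fin.snoc (a + w) ((h + 1 : ℕ) : ℤ) : Fin (d+1) → ℤ) = liftZ a + Fin.snoc w (h : ℤ) := by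
  ext i
  refine Fin.lastCases ?_ (fun j => ?_) i
  · simp [liftZ, add_comm]
  · simp [liftZ]

/-- the matrix of lifted vertices -/
def vMat {d : ℕ} (v : Fin (d + 1) → Fin d → ℤ) : Matrix (Fin (d+1)) (Fin (d+1)) ℤ :=
  Matrix.of fun r c => liftZ (v c) r

theorem vMat_last {d : ℕ} (v : Fin (d + 1) → Fin d → ℤ) (x : Fin (d+1) → ℤ) :
    ((vMat v).mulVec x) (Fin.last d) = ∑ i, x i := by
  simp [vMat, Matrix.mulVec, dotProduct, liftZ]

theorem vMat_single {d : ℕ} (v : Fin (d + 1) → Fin d → ℤ) (i : Fin (d+1)) :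
    (vMat v).mulVec (Pi.single i 1) = liftZ (v i) := by
  ext j
  simp [vMat]

theorem vMat_det_ne_zero {d : ℕ} (v : Fin (d + 1) → Fin d → ℤ)
    (haff : AffineIndependent ℝ (fun i (j : Fin d) => (v i j : ℝ))) : (vMat v).det ≠ 0 := by
  intro h0
  obtain ⟨w, hw, hw0⟩ := Matrix.exists_mulVec_eq_zero_iff.2 h0
  apply hw
  rw [affineIndependent_iff] at haff
  have h1 : ∑ i, w i = 0 := by rw [← vMat_last v, hw0]; rfl
  have := haff Finset.univ (fun i => (w i : ℝ)) (by exact_mod_cast h1) (by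
    ext j
    have := congrFun hw0 j.castSucc
    simp only [vMat, Matrix.mulVec, dotProduct, liftZ, Matrix.of_apply, Fin.snoc_castSucc,
      Pi.zero_apply] at this
    simp only [Finset.sum_apply, Pi.smul_apply, smul_eq_mul, Pi.zero_apply]
    have h2 : ∑ i, (w i) * (v i j) = 0 := by
      rw [← this]; exact Finset.sum_congr rfl (fun i _ => mul_comm _ _)
    exact_mod_cast h2)
  ext i
  exact_mod_cast this i (Finset.mem_univ i)

/-- scaled barycentric coordinates -/
def vInv {d : ℕ} (v : Fin (d + 1) → Fin d → ℤ) : (Fin (d+1) → ℤ) →ₗ[ℤ] (Fin (d+1) → ℤ) :=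
  Matrix.mulVecLin ((vMat v).det.sign • (vMat v).adjugate)

theorem vInv_vMat {d : ℕ} (v : Fin (d + 1) → Fin d → ℤ) (c : Fin (d+1) → ℤ) :
    vInv v ((vMat v).mulVec c) = |(vMat v).det| • c := by
  simp only [vInv, Matrix.mulVecLin_apply, Matrix.mulVec_mulVec, Matrix.smul_mul,
    Matrix.adjugate_mul, smul_smul, Int.sign_mul_self_eq_abs, Matrix.smul_mulVec, Matrix.one_mulVec]

theorem vMat_vInv {d : ℕ} (v : Fin (d + 1) → Fin d → ℤ) (c : Fin (d+1) → ℤ) :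
    (vMat v).mulVec (vInv v c) = |(vMat v).det| • c := by
  rw [vInv, Matrix.mulVecLin_apply, Matrix.mulVec_mulVec, Matrix.mul_smul,
    Matrix.mul_adjugate, smul_smul, Int.sign_mul_self_eq_abs, Matrix.smul_mulVec, Matrix.one_mulVec]

theorem index_vMat {d : ℕ} (v : Fin (d + 1) → Fin d → ℤ) (h0 : (vMat v).det ≠ 0) :
    (LinearMap.range (vMat v).mulVecLin).toAddSubgroup.index = (vMat v).det.natAbs := by
  have hinj : Function.Injective (vMat v).mulVecLin := by
    rw [Matrix.mulVecLin, LinearMap.coe_mk]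
    exact Matrix.mulVec_injective_of_det_ne_zero h0
  have := Submodule.natAbs_det_equiv (LinearMap.range (vMat v).mulVecLin)
    (LinearEquiv.ofInjective _ hinj)
  rw [AddSubgroup.index]
  rw [← LinearMap.det_toLin' (vMat v)]
  exact this.symm

/-- reduction of scaled barycentric coordinates modulo `D` -/
def vRed {d : ℕ} (v : Fin (d + 1) → Fin d → ℤ) (D : ℕ) :
    (Fin (d+1) → ℤ) →+ (Fin (d+1) → ZMod D) :=
  ((Int.castAddHom (ZMod D)).compLeft (Fin (d+1))).comp (vInv v).toAddMonoidHom

theorem vRed_card {d : ℕ} (v : Fin (d + 1) → Fin d → ℤ) (D : ℕ)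
    (hD : (D : ℤ) = |(vMat v).det|) (h0 : (vMat v).det ≠ 0) :
    Nat.card (vRed v D).range ≤ D := by
  have hDn : (vMat v).det.natAbs = D := by rw [Int.abs_eq_natAbs] at hD; omega
  have hD0 : D ≠ 0 := by omega
  rw [← AddSubgroup.index_ker]
  apply Nat.le_of_dvd (by omega)
  have h1 := index_vMat v h0
  rw [hDn] at h1
  conv_rhs => rw [← h1]
  apply AddSubgroup.index_dvd_of_le
  rintro _ ⟨c, rfl⟩
  rw [AddMonoidHom.mem_ker]
  ext i
  simp only [vRed, AddMonoidHom.comp_apply, LinearMap.toAddMonoidHom_coe, Matrix.mulVecLin_apply,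
    vInv_vMat, ← hD]
  simp

/-- natural-number coordinates as integers -/
def toI {d : ℕ} (x : Fin (d+1) → ℕ) : Fin (d+1) → ℤ := fun i => (x i : ℤ)

theorem toI_add {d : ℕ} (x y : Fin (d+1) → ℕ) : toI (x + y) = toI x + toI y := by
  ext; simp [toI]

theorem exists_coord {d : ℕ} (v : Fin (d + 1) → Fin d → ℤ) (D : ℕ)
    (hD : (D : ℤ) = |(vMat v).det|) (a : Fin d → ℤ)
    (ha : (fun j => (a j : ℝ)) ∈ convexHull ℝ (Set.range (fun i (j : Fin d) => (v i j : ℝ)))) :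
    ∃ x : Fin (d+1) → ℕ, (vMat v).mulVec (toI x) = D • liftZ a := by
  have hform : ∀ (b : Fin d → ℤ) i, vInv v (liftZ b) i =
      ∑ j : Fin d, ((vMat v).det.sign • (vMat v).adjugate) i j.castSucc * b j +
        ((vMat v).det.sign • (vMat v).adjugate) i (Fin.last d) := by
    intro b i
    rw [vInv, Matrix.mulVecLin_apply, Matrix.mulVec, dotProduct, Fin.sum_univ_castSucc]
    simp [liftZ]
  have hpos : ∀ i, 0 ≤ vInv v (liftZ a) i := by
    intro i
    let φ : (Fin d → ℝ) →ₗ[ℝ] ℝ := ∑ j : Fin d,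
      ((((vMat v).det.sign • (vMat v).adjugate) i j.castSucc : ℤ) : ℝ) • LinearMap.proj j
    have hφ : ∀ b : Fin d → ℤ, φ (fun j => (b j : ℝ)) =
        ((vInv v (liftZ b) i - ((vMat v).det.sign • (vMat v).adjugate) i (Fin.last d) : ℤ) : ℝ) := by
      intro b
      rw [hform b i]
      simp [φ, LinearMap.sum_apply]
    have hconv := convex_halfSpace_ge (𝕜 := ℝ) φ.isLinear
      (-((((vMat v).det.sign • (vMat v).adjugate) i (Fin.last d) : ℤ) : ℝ))
    have := convexHull_min (s := Set.range (fun i (j : Fin d) => (v i j : ℝ))) (by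
      rintro _ ⟨k, rfl⟩
      simp only [Set.mem_ofPred_eq]
      rw [hφ (v k)]
      have h1 : 0 ≤ vInv v (liftZ (v k)) i := by
        rw [← vMat_single, vInv_vMat, Pi.smul_apply, smul_eq_mul]
        apply mul_nonneg (abs_nonneg _)
        by_cases hik : i = k
        · subst hik; simp
        · simp [hik]
      have h2 : (0 : ℝ) ≤ (vInv v (liftZ (v k)) i : ℤ) := by exact_mod_cast h1
      push_cast
      linarith) hconv ha
    simp only [Set.mem_ofPred_eq] at this
    rw [hφ a] at this
    push_cast at this
    have h3 : (0 : ℝ) ≤ (vInv v (liftZ a) i : ℤ) := by linarith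
    exact_mod_cast h3
  refine ⟨fun i => (vInv v (liftZ a) i).toNat, ?_⟩
  have : toI (fun i => (vInv v (liftZ a) i).toNat) = vInv v (liftZ a) := by
    ext i
    exact Int.toNat_of_nonneg (hpos i)
  rw [this, vMat_vInv, ← hD]
  simp

/-- the non-vertex generators in scaled barycentric coordinates -/
def genP {d : ℕ} (v : Fin (d + 1) → Fin d → ℤ) (A : Set (Fin d → ℤ)) (D : ℕ) :
    Set (Fin (d+1) → ℕ) :=
  {x | (∀ i, x i < D) ∧ ∃ a ∈ A, (vMat v).mulVec (toI x) = D • liftZ a}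

theorem height_eq {d : ℕ} (v : Fin (d + 1) → Fin d → ℤ) (D : ℕ) (x : Fin (d+1) → ℕ)
    (w : Fin d → ℤ) (h : ℕ) (hx : (vMat v).mulVec (toI x) = D • (Fin.snoc w (h:ℤ) : Fin (d+1) → ℤ)) :
    ∑ i, x i = D * h := by
  have := congrFun hx (Fin.last d)
  rw [vMat_last] at this
  simp [toI] at this
  exact_mod_cast this

theorem height_one {d : ℕ} (v : Fin (d + 1) → Fin d → ℤ) (D : ℕ) (x : Fin (d+1) → ℕ)
    (w : Fin d → ℤ) (hx : (vMat v).mulVec (toI x) = D • liftZ w) :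
    ∑ i, x i = D := by
  have := height_eq v D x w 1 (by simpa [liftZ] using hx)
  simpa using this

theorem backward {d : ℕ} (v : Fin (d + 1) → Fin d → ℤ) (A : Set (Fin d → ℤ)) (D : ℕ)
    (hA : ∀ a ∈ A, ∃ x : Fin (d+1) → ℕ, (vMat v).mulVec (toI x) = D • liftZ a)
    (h : ℕ) : ∀ w ∈ iterSumset A h, ∃ x ∈ monT D (genP v A D),
      (vMat v).mulVec (toI x) = D • (Fin.snoc w (h:ℤ) : Fin (d+1) → ℤ) := by
  induction h with
  | zero =>
    intro w hw
    have hw : w = 0 := hw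
    subst hw
    refine ⟨0, ⟨0, [], by simp, by simp⟩, ?_⟩
    have h1 : toI (0 : Fin (d+1) → ℕ) = 0 := by ext; simp [toI]
    have h2 : (Fin.snoc (0 : Fin d → ℤ) ((0 : ℕ) : ℤ) : Fin (d+1) → ℤ) = 0 := by
      ext i
      refine Fin.lastCases ?_ (fun j => ?_) i <;> simp
    rw [h1, h2]; simp
  | succ h ih =>
    intro w hw
    obtain ⟨a, ha, w', hw', rfl⟩ := Set.mem_add.1 hw
    obtain ⟨x', ⟨c, l, hl, rfl⟩, hx'⟩ := ih w' hw'
    obtain ⟨x, hx⟩ := hA a ha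
    have heq : (vMat v).mulVec (toI (x + (D • c + l.sum))) =
        D • (Fin.snoc (a + w') ((h + 1 : ℕ):ℤ) : Fin (d+1) → ℤ) := by
      rw [toI_add, Matrix.mulVec_add, hx, hx', snoc_add_one, smul_add]
    refine ⟨_, ?_, heq⟩
    by_cases hlt : ∀ i, x i < D
    · refine ⟨c, x :: l, ?_, ?_⟩
      · intro b hb
        rcases List.mem_cons.1 hb with rfl | hb
        · exact ⟨hlt, a, ha, hx⟩
        · exact hl b hb
      · rw [List.sum_cons]; abel
    · push Not at hlt
      obtain ⟨i, hi⟩ := hlt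
      have hs := height_one v D x a hx
      have hxi : x = D • Pi.single i 1 := by
        have h1 := Finset.add_sum_erase Finset.univ x (Finset.mem_univ i)
        ext j
        by_cases hj : j = i
        · subst hj; simp; omega
        · have h2 : x j ≤ ∑ k ∈ Finset.univ.erase i, x k :=
            Finset.single_le_sum (fun _ _ => Nat.zero_le _) (by simp [hj])
          simp [hj]; omega
      refine ⟨Pi.single i 1 + c, l, hl, ?_⟩
      rw [hxi, smul_add]; abel

/-- `x` comes from an element of the `h`-fold sumset -/
def good {d : ℕ} (v : Fin (d + 1) → Fin d → ℤ) (A : Set (Fin d → ℤ)) (D : ℕ)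
    (x : Fin (d+1) → ℕ) (h : ℕ) : Prop :=
  ∃ w ∈ iterSumset A h, (vMat v).mulVec (toI x) = D • (Fin.snoc w (h:ℤ) : Fin (d+1) → ℤ)

theorem good_step {d : ℕ} (v : Fin (d + 1) → Fin d → ℤ) (A : Set (Fin d → ℤ)) (D : ℕ)
    (x y : Fin (d+1) → ℕ) (h : ℕ) (a : Fin d → ℤ) (ha : a ∈ A)
    (hx : (vMat v).mulVec (toI x) = D • liftZ a) (hy : good v A D y h) :
    good v A D (x + y) (h+1) := by
  obtain ⟨w, hw, hy⟩ := hy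
  refine ⟨a + w, Set.add_mem_add ha hw, ?_⟩
  rw [toI_add, Matrix.mulVec_add, hx, hy, snoc_add_one, smul_add]

theorem good_list {d : ℕ} (v : Fin (d + 1) → Fin d → ℤ) (A : Set (Fin d → ℤ)) (D : ℕ)
    (l : List (Fin (d+1) → ℕ)) (hl : ∀ x ∈ l, x ∈ genP v A D) : good v A D l.sum l.length := by
  induction l with
  | nil =>
    refine ⟨0, rfl, ?_⟩
    have h1 : toI (0 : Fin (d+1) → ℕ) = 0 := by ext; simp [toI]
    have h2 : (Fin.snoc (0 : Fin d → ℤ) ((0 : ℕ) : ℤ) : Fin (d+1) → ℤ) = 0 := by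
      ext i
      refine Fin.lastCases ?_ (fun j => ?_) i <;> simp
    rw [List.sum_nil, h1, List.length_nil, h2]; simp
  | cons x l ih =>
    obtain ⟨-, a, ha, hx⟩ := hl x (by simp)
    exact good_step v A D x l.sum _ a ha hx (ih (fun y hy => hl y (by simp [hy])))

theorem good_vert {d : ℕ} (v : Fin (d + 1) → Fin d → ℤ) (A : Set (Fin d → ℤ)) (D : ℕ)
    (hvA : ∀ i, v i ∈ A) (y : Fin (d+1) → ℕ) (k : ℕ) (hy : good v A D y k) (m : ℕ) :
    ∀ c : Fin (d+1) → ℕ, ∑ i, c i = m → good v A D (D • c + y) (m + k) := by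
  induction m with
  | zero =>
    intro c hc
    have : c = 0 := by
      ext i
      exact (Finset.sum_eq_zero_iff.1 hc) i (Finset.mem_univ i)
    subst this
    simpa using hy
  | succ m ih =>
    intro c hc
    obtain ⟨i, -, hi⟩ : ∃ i ∈ Finset.univ, c i ≠ 0 := by
      apply Finset.exists_ne_zero_of_sum_ne_zero
      omega
    have hle : Pi.single i 1 ≤ c := by
      intro j
      by_cases hj : j = i
      · subst hj; simp; omega
      · simp [hj]
    have hc' : c = Pi.single i 1 + (c - Pi.single i 1) := (add_tsub_cancel_of_le hle).symm
    have hs : ∑ j, (c - Pi.single i 1 : Fin (d+1) → ℕ) j = m := by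
      have : ∑ j, c j = ∑ j, (Pi.single i 1 : Fin (d+1) → ℕ) j + ∑ j, (c - Pi.single i 1 : Fin (d+1) → ℕ) j := by
        rw [← Finset.sum_add_distrib]
        exact Finset.sum_congr rfl (fun j _ => congrFun hc' j)
      simp only [Finset.sum_pi_single', Finset.mem_univ, if_true] at this
      omega
    have h1 := ih _ hs
    have h2 := good_step v A D (D • Pi.single i 1) _ _ (v i) (hvA i) (by
      have : toI (D • (Pi.single i 1 : Fin (d+1) → ℕ)) = (D : ℤ) • Pi.single i 1 := by
        ext j
        by_cases hj : j = i
        · subst hj; simp [toI]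
        · simp [toI, hj]
      rw [this, Matrix.mulVec_smul, vMat_single]; simp) h1
    rw [← add_assoc, ← smul_add, ← hc'] at h2
    rwa [show m + 1 + k = m + k + 1 by omega]

theorem effective_khovanskii_simplex (d : ℕ) (hd : 1 ≤ d) (A : Set (Fin d → ℤ))
    (hfin : A.Finite)
    (hgen : AddSubgroup.closure (A - A) = ⊤)
    (v : Fin (d + 1) → Fin d → ℤ) (hvA : ∀ i, v i ∈ A)
    (haff : AffineIndependent ℝ (fun i (j : Fin d) => (v i j : ℝ)))
    (hhull : ∀ a ∈ A, (fun j => (a j : ℝ)) ∈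
      convexHull ℝ (Set.range (fun i (j : Fin d) => (v i j : ℝ))))
    (D : ℕ) (hD : (D : ℤ) = |(Matrix.of fun r c => liftZ (v c) r).det|) :
    ∃ p : Polynomial ℚ, ∀ h : ℕ, ((d + 1) * D : ℤ) - 1 - 3 * d ≤ (h : ℤ) →
      ((iterSumset A h).ncard : ℚ) = p.eval (h : ℚ) := by
  classical
  change (D : ℤ) = |(vMat v).det| at hD
  have h0 := vMat_det_ne_zero v haff
  have hDpos : 0 < D := by
    have := abs_pos.2 h0
    omega
  have hcancel : ∀ (x : Fin (d+1) → ℕ) (z : Fin (d+1) → ℤ),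
      (vMat v).mulVec (toI x) = D • z → toI x = vInv v z := by
    intro x z hx
    have h1 := congrArg (vInv v) hx
    rw [vInv_vMat, ← hD, map_nsmul] at h1
    ext i
    have h2 := congrFun h1 i
    simpa [hDpos.ne'] using h2
  have hfinH : Finite (vRed v D).range := by
    have : NeZero D := ⟨hDpos.ne'⟩
    infer_instance
  obtain ⟨p, hp⟩ := abstract_main_s5 (D := D) (genP v A D) (fun a ha => ha.1)
    (by rintro x ⟨-, a, -, hx⟩; exact height_one v D x a hx)
    (vRed v D).range (vRed_card v D hD h0) (by
      rintro x ⟨-, a, -, hx⟩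
      refine ⟨liftZ a, ?_⟩
      have := hcancel x _ hx
      ext i
      have h2 := congrFun this i
      simp only [vRed, AddMonoidHom.comp_apply, LinearMap.toAddMonoidHom_coe, ← this]
      simp [toI])
  refine ⟨p, fun h hh => ?_⟩
  rw [← hp h hh]
  congr 1
  symm
  have hgood : ∀ x : Fin (d+1) → ℕ, x ∈ monT D (genP v A D) ∧ ∑ i, x i = D * h →
      good v A D x h := by
    rintro x ⟨⟨c, l, hl, rfl⟩, hs⟩
    have hg := good_vert v A D hvA _ _ (good_list v A D l hl) _ c rfl
    have hg' := hg
    obtain ⟨w, -, hw⟩ := hg'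
    have := height_eq v D _ w _ hw
    rw [hs] at this
    have := Nat.eq_of_mul_eq_mul_left hDpos this
    rwa [this]
  apply Set.ncard_congr (fun (x : Fin (d+1) → ℕ) hx => (hgood x hx).choose)
  · intro x hx
    exact (hgood x hx).choose_spec.1
  · intro x y hx hy hxy
    have h1 := (hgood x hx).choose_spec.2
    have h2 := (hgood y hy).choose_spec.2
    rw [hxy] at h1
    have h3 := (hcancel _ _ h1).trans (hcancel _ _ h2).symm
    ext i
    have := congrFun h3 i
    simpa [toI] using this
  · intro w hw
    obtain ⟨x, hx, hxw⟩ := backward v A D (fun a ha => exists_coord v D hD a (hhull a ha)) h w hw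
    have hx' : x ∈ monT D (genP v A D) ∧ ∑ i, x i = D * h := ⟨hx, height_eq v D x w h hxw⟩
    refine ⟨x, hx', ?_⟩
    have h1 := hxw.symm.trans (hgood x hx').choose_spec.2
    ext j
    have := congrFun h1 j.castSucc
    simp [hDpos.ne'] at this
    exact this.symm
end

section
/- Let d ≥ 1, let A ⊆ ℤ^d be finite, and suppose v_1, …, v_{d+1} ∈ A are affinely independent over ℝ and A is contained in the convex hull of {v_1, …, v_{d+1}}. Let Λ := ℤ-span of {ṽ_1, …, ṽ_{d+1}} ⊆ ℤ^{d+1}, fix π ∈ ℤ^{d+1} with π ∉ Λ, and set S_π := {x ∈ C_A : x − π ∈ Λ}. Suppose S_π is nonempty and let M ∈ ℕ be such that every minimal element of C_A lying in S_π has height at most M. Then there exists a polynomial P ∈ ℚ[t] of degree at most (d+1)·M − d such that the identity (∑_{h≥0} c_h t^h) · (1−t)^{d+1} = P(t) holds in ℚ[[t]], where c_h := #{x ∈ S_π : height(x) = h} (a finite number for each h). -/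
open Pointwise

/-- The cone over `A`: all `ℕ`-linear combinations of lifts of elements of `A`. -/
def coneOver {d : ℕ} (A : Set (Fin d → ℤ)) : Set (Fin (d + 1) → ℤ) :=
  (AddSubmonoid.closure (liftZ '' A) : AddSubmonoid (Fin (d + 1) → ℤ))


open Finset in
/-- Generating series of an eventually constant subset of `ℕ^ι`. -/
theorem trunc_series {ι : Type*} [Fintype ι] [DecidableEq ι] (U : Set (ι → ℕ)) (D : ℕ)
    (hU : ∀ n : ι → ℕ, n ∈ U ↔ (fun i => min (n i) D) ∈ U) :
    ∃ Q : Polynomial ℚ, Q.natDegree ≤ Fintype.card ι * D ∧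
      (PowerSeries.mk fun h : ℕ => (({n ∈ U | ∑ i, n i = h}.ncard : ℚ))) *
        (1 - PowerSeries.X) ^ (Fintype.card ι) = (Q : PowerSeries ℚ) := by
  classical
  let g : ℕ → Polynomial ℚ := fun j =>
    if j < D then Polynomial.X ^ j * (1 - Polynomial.X) else Polynomial.X ^ D
  let G : ℕ → PowerSeries ℚ := fun j => PowerSeries.mk fun n => if min n D = j then 1 else 0
  have hg : ∀ j, (g j).natDegree ≤ D := by
    intro j
    simp only [g]
    split_ifs with h
    · refine (Polynomial.natDegree_mul_le).trans ?_
      have h1 : (1 - Polynomial.X : Polynomial ℚ).natDegree ≤ 1 := by compute_degree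
      simp only [Polynomial.natDegree_X_pow]
      omega
    · simp
  have hG : ∀ j ≤ D, G j * (1 - PowerSeries.X) = (g j : PowerSeries ℚ) := by
    intro j hj
    ext n
    rw [mul_sub, mul_one, map_sub]
    simp only [G, g]
    rcases n with _ | n
    · rw [PowerSeries.coeff_zero_mul_X]
      by_cases h : j < D
      · simp only [h, if_true]
        rw [Polynomial.coeff_coe, mul_sub, mul_one, ← pow_succ]
        simp [Polynomial.coeff_X_pow, eq_comm]
      · simp only [h, if_false]
        rw [Polynomial.coeff_coe]
        have : j = D := by omega
        simp [Polynomial.coeff_X_pow, eq_comm, this]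
    · rw [PowerSeries.coeff_succ_mul_X]
      by_cases h : j < D
      · simp only [h, if_true]
        rw [Polynomial.coeff_coe, mul_sub, mul_one, ← pow_succ]
        simp only [Polynomial.coeff_X_pow, PowerSeries.coeff_mk, Polynomial.coeff_sub]
        congr 1 <;> congr 1 <;> apply propext <;> omega
      · simp only [h, if_false]
        rw [Polynomial.coeff_coe]
        simp only [Polynomial.coeff_X_pow, PowerSeries.coeff_mk]
        split_ifs <;> first | omega | norm_num
  let B : Finset (ι → ℕ) := (Fintype.piFinset fun _ => Finset.range (D + 1)).filter (· ∈ U)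
  have key : (PowerSeries.mk fun h : ℕ => (({n ∈ U | ∑ i, n i = h}.ncard : ℚ))) =
      ∑ m ∈ B, ∏ i, G (m i) := by
    ext h
    rw [map_sum, PowerSeries.coeff_mk]
    have e : {n ∈ U | ∑ i, n i = h} = ((univ.piAntidiag h).filter (· ∈ U) : Finset (ι → ℕ)) := by
      ext n; simp [and_comm]
    rw [e, Set.ncard_coe_finset]
    have c : ∀ m : ι → ℕ, (PowerSeries.coeff h) (∏ i, G (m i)) =
        ∑ n ∈ univ.piAntidiag h, if (fun i => min (n i) D) = m then (1 : ℚ) else 0 := by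
      intro m
      rw [PowerSeries.coeff_prod]
      refine Finset.sum_bij (fun l _ => (l : ι → ℕ)) ?_ ?_ ?_ ?_
      · intro l hl
        simpa [Finset.mem_finsuppAntidiag] using hl
      · intro a _ b _ hab
        exact DFunLike.coe_injective hab
      · intro n hn
        refine ⟨Finsupp.equivFunOnFinite.symm n, ?_, ?_⟩
        · simpa [Finset.mem_finsuppAntidiag] using hn
        · simp
      · intro l hl
        simp only [G, PowerSeries.coeff_mk]
        rw [Finset.prod_ite_zero]
        simp [funext_iff]
    simp_rw [c]
    rw [Finset.sum_comm, Finset.card_filter]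
    push_cast
    refine Finset.sum_congr rfl fun n _ => ?_
    rw [Finset.sum_ite_eq]
    congr 1
    apply propext
    rw [hU n]
    simp only [B, Finset.mem_filter, Fintype.mem_piFinset, Finset.mem_range]
    constructor
    · intro h; exact ⟨fun i => by omega, h⟩
    · exact fun h => h.2
  refine ⟨∑ m ∈ B, ∏ i, g (m i), ?_, ?_⟩
  · refine Polynomial.natDegree_sum_le_of_forall_le _ _ fun m _ => ?_
    refine (Polynomial.natDegree_prod_le _ _).trans ?_
    refine (Finset.sum_le_card_nsmul _ _ D fun i _ => hg _).trans ?_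
    simp
  · rw [key, Finset.sum_mul]
    rw [← Polynomial.coeToPowerSeries.ringHom_apply, map_sum]
    refine Finset.sum_congr rfl fun m hm => ?_
    rw [map_prod, ← Finset.card_univ, ← Finset.prod_const, ← Finset.prod_mul_distrib]
    refine Finset.prod_congr rfl fun i _ => ?_
    rw [Polynomial.coeToPowerSeries.ringHom_apply]
    apply hG
    simp only [B, Finset.mem_filter, Fintype.mem_piFinset, Finset.mem_range] at hm
    have := hm.1 i
    omega

/-- Barycentric coordinates on the cone. -/
theorem exists_coords (d : ℕ) (A : Set (Fin d → ℤ))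
    (v : Fin (d + 1) → Fin d → ℤ)
    (haff : AffineIndependent ℝ (fun i (j : Fin d) => (v i j : ℝ)))
    (hhull : ∀ a ∈ A, (fun j => (a j : ℝ)) ∈
      convexHull ℝ (Set.range (fun i (j : Fin d) => (v i j : ℝ)))) :
    ∃ L : Fin (d + 1) → (Fin (d + 1) → ℤ) →+ ℝ,
      (∀ i j, L i (liftZ (v j)) = if i = j then 1 else 0) ∧
      (∀ x ∈ coneOver A, ∀ i, 0 ≤ L i x) ∧
      (∀ x, ∑ i, L i x = (x (Fin.last d) : ℝ)) ∧
      (∀ x, (∀ i, L i x = 0) → x = 0) := by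
  classical
  let w : Fin (d + 1) → Fin (d + 1) → ℝ := fun i => Fin.snoc (fun j => (v i j : ℝ)) 1
  have hli : LinearIndependent ℝ w := by
    rw [Fintype.linearIndependent_iff]
    intro c hc
    rw [affineIndependent_iff] at haff
    have h1 : ∑ i, c i = 0 := by
      have := congrFun hc (Fin.last d)
      simpa [w, Finset.sum_apply] using this
    have h2 : ∑ i, c i • (fun j => (v i j : ℝ)) = 0 := by
      ext j
      have := congrFun hc j.castSucc
      simpa [w, Finset.sum_apply] using this
    intro i
    exact haff Finset.univ c h1 h2 i (Finset.mem_univ i)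
  let b := basisOfLinearIndependentOfCardEqFinrank hli (by simp)
  have hb : ∀ i, b i = w i := fun i => by simp [b]
  let cst : (Fin (d + 1) → ℤ) →+ (Fin (d + 1) → ℝ) :=
    { toFun := fun x j => (x j : ℝ)
      map_zero' := by ext; simp
      map_add' := fun x y => by ext; simp }
  have hcst : ∀ x : Fin d → ℤ, cst (liftZ x) = Fin.snoc (fun j => (x j : ℝ)) 1 := by
    intro x
    ext j
    refine Fin.lastCases ?_ (fun j => ?_) j <;> simp [cst, liftZ]
  let L : Fin (d + 1) → (Fin (d + 1) → ℤ) →+ ℝ := fun i =>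
    (b.coord i).toAddMonoidHom.comp cst
  have hL : ∀ i x, L i x = b.repr (cst x) i := fun i x => rfl
  have hLv : ∀ i j, L i (liftZ (v j)) = if i = j then 1 else 0 := by
    intro i j
    rw [hL, hcst]
    change b.repr (w j) i = _
    rw [← hb, b.repr_self, Finsupp.single_apply]
    simp [eq_comm]
  refine ⟨L, hLv, ?_, ?_, ?_⟩
  · intro x hx i
    have hA : ∀ a ∈ A, 0 ≤ L i (liftZ a) := by
      intro a ha
      let T : Set (Fin d → ℝ) := {y | 0 ≤ b.coord i (Fin.snoc y 1 : Fin (d + 1) → ℝ)}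
      have hT : Convex ℝ T := by
        intro y hy z hz α β hα hβ hab
        simp only [T, Set.mem_ofPred_eq] at hy hz ⊢
        have : (Fin.snoc (α • y + β • z) 1 : Fin (d + 1) → ℝ) =
            α • (Fin.snoc y 1 : Fin (d + 1) → ℝ) + β • (Fin.snoc z 1 : Fin (d + 1) → ℝ) := by
          ext j
          refine Fin.lastCases ?_ (fun j => ?_) j <;> simp [hab]
        rw [this, map_add, map_smul, map_smul]
        simp only [smul_eq_mul]
        positivity
      have := convexHull_min (s := Set.range (fun i (j : Fin d) => (v i j : ℝ))) (t := T) (by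
        rintro _ ⟨j, rfl⟩
        have h0 := hLv i j
        rw [hL, hcst] at h0
        simp only [T, Set.mem_ofPred_eq, Module.Basis.coord_apply]
        rw [h0]; split_ifs <;> norm_num) hT (hhull a ha)
      rw [hL, hcst]
      exact this
    refine AddSubmonoid.closure_induction (motive := fun x _ => 0 ≤ L i x) ?_ ?_ ?_ hx
    · rintro _ ⟨a, ha, rfl⟩; exact hA a ha
    · simp
    · intro x y _ _ hx hy
      rw [map_add]; positivity
  · intro x
    have := congrFun (b.sum_repr (cst x)) (Fin.last d)
    simp only [Finset.sum_apply, Pi.smul_apply, hb, w, Fin.snoc_last, smul_eq_mul, mul_one] at this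
    exact this
  · intro x hx
    have : cst x = 0 := b.ext_elem fun i => by rw [← hL, hx]; simp
    ext j
    have := congrFun this j
    simpa [cst] using this

theorem residue_class_generating_series (d : ℕ) (hd : 1 ≤ d) (A : Set (Fin d → ℤ))
    (hfin : A.Finite)
    (v : Fin (d + 1) → Fin d → ℤ) (hvA : ∀ i, v i ∈ A)
    (haff : AffineIndependent ℝ (fun i (j : Fin d) => (v i j : ℝ)))
    (hhull : ∀ a ∈ A, (fun j => (a j : ℝ)) ∈
      convexHull ℝ (Set.range (fun i (j : Fin d) => (v i j : ℝ))))
    (Λ : AddSubgroup (Fin (d + 1) → ℤ))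
    (hΛ : Λ = AddSubgroup.closure (Set.range fun i => liftZ (v i)))
    (π : Fin (d + 1) → ℤ) (hπ : π ∉ Λ)
    (S : Set (Fin (d + 1) → ℤ)) (hS : S = {x | x ∈ coneOver A ∧ x - π ∈ Λ})
    (hSne : S.Nonempty)
    (M : ℕ)
    (hM : ∀ x ∈ S, (∀ i : Fin (d + 1), x - liftZ (v i) ∉ coneOver A) →
      x (Fin.last d) ≤ (M : ℤ)) :
    ∃ P : Polynomial ℚ, P.natDegree ≤ (d + 1) * M - d ∧
      (PowerSeries.mk fun h : ℕ =>
          (({x ∈ S | x (Fin.last d) = (h : ℤ)}.ncard : ℚ))) *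
        (1 - PowerSeries.X) ^ (d + 1) = (P : PowerSeries ℚ) := by
  classical
  obtain ⟨L, hLv, hLpos, hLsum, hLinj⟩ := exists_coords d A v haff hhull
  have hwΛ : ∀ i, liftZ (v i) ∈ Λ := fun i => by
    rw [hΛ]; exact AddSubgroup.subset_closure ⟨i, rfl⟩
  have hwC : ∀ i, ∀ x ∈ coneOver A, x + liftZ (v i) ∈ coneOver A := fun i x hx =>
    AddSubmonoid.add_mem _ hx (AddSubmonoid.subset_closure ⟨v i, hvA i, rfl⟩)
  have hsumΛ : ∀ z : Fin (d + 1) → ℤ, ∑ i, z i • liftZ (v i) ∈ Λ := fun z =>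
    AddSubgroup.sum_mem _ fun i _ => AddSubgroup.zsmul_mem _ (hwΛ i) _
  have hΛrep : ∀ x ∈ Λ, ∃ z : Fin (d + 1) → ℤ, x = ∑ i, z i • liftZ (v i) := by
    intro x hx
    rw [hΛ] at hx
    refine AddSubgroup.closure_induction
      (p := fun x _ => ∃ z : Fin (d + 1) → ℤ, x = ∑ i, z i • liftZ (v i)) ?_ ?_ ?_ ?_ hx
    · rintro _ ⟨i, rfl⟩
      exact ⟨Pi.single i 1, by simp [Pi.single_apply]⟩
    · exact ⟨0, by simp⟩
    · rintro _ _ _ _ ⟨z, rfl⟩ ⟨z', rfl⟩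
      exact ⟨z + z', by simp [add_smul, Finset.sum_add_distrib]⟩
    · rintro _ _ ⟨z, rfl⟩
      exact ⟨-z, by simp⟩
  have hLz : ∀ i (z : Fin (d + 1) → ℤ), L i (∑ j, z j • liftZ (v j)) = z i := by
    intro i z
    rw [map_sum]
    simp only [map_zsmul, hLv]
    simp
  obtain ⟨x0, hx0⟩ := hSne
  have hx0' := hx0
  rw [hS] at hx0'
  obtain ⟨hx0C, hx0π⟩ := hx0'
  set p := x0 - ∑ i, ⌊L i x0⌋ • liftZ (v i) with hp
  have hLp : ∀ i, L i p = Int.fract (L i x0) := by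
    intro i
    rw [hp, map_sub, hLz i (fun i => ⌊L i x0⌋)]
    rfl
  have hpπ : p - π ∈ Λ := by
    have := Λ.sub_mem hx0π (hsumΛ fun i => ⌊L i x0⌋)
    convert this using 1
    rw [hp]; abel
  have hpΛ : p ∉ Λ := by
    intro h
    apply hπ
    have := Λ.sub_mem h hpπ
    simpa using this
  have hH0 : 1 ≤ p (Fin.last d) := by
    have hnn : ∀ i, 0 ≤ L i p := fun i => by rw [hLp]; exact Int.fract_nonneg _
    have h0 : (0 : ℝ) < p (Fin.last d) := by
      rw [← hLsum]
      refine lt_of_le_of_ne (Finset.sum_nonneg fun i _ => hnn i) fun h => ?_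
      have := (Finset.sum_eq_zero_iff_of_nonneg fun i _ => hnn i).1 h.symm
      apply hpΛ
      rw [hLinj p fun i => this i (Finset.mem_univ i)]
      exact Λ.zero_mem
    have : 0 < p (Fin.last d) := by exact_mod_cast h0
    omega
  obtain ⟨H, hH⟩ : ∃ H : ℕ, p (Fin.last d) = H := ⟨_, (Int.toNat_of_nonneg (by omega)).symm⟩
  have hH1 : 1 ≤ H := by omega
  let φ : (Fin (d + 1) → ℕ) → (Fin (d + 1) → ℤ) := fun n => p + ∑ i, (n i : ℤ) • liftZ (v i)
  have hφinj : Function.Injective φ := by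
    intro m n h
    have h' := add_left_cancel h
    ext i
    have := congrArg (L i) h'
    rw [hLz i (fun i => (m i : ℤ)), hLz i (fun i => (n i : ℤ))] at this
    exact_mod_cast this
  have hφlast : ∀ n, φ n (Fin.last d) = (H : ℤ) + ((∑ i, n i : ℕ) : ℤ) := by
    intro n
    simp [φ, hH, liftZ, Finset.sum_apply]
  have hφS : ∀ n, φ n ∈ coneOver A → φ n ∈ S := by
    intro n hn
    rw [hS]
    refine ⟨hn, ?_⟩
    have := Λ.add_mem hpπ (hsumΛ fun i => (n i : ℤ))
    convert this using 1
    simp only [φ]; abel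
  have hSφ : ∀ x ∈ coneOver A, x - π ∈ Λ → ∃ n, x = φ n := by
    intro x hxC hxπ
    have h1 : x - p ∈ Λ := by
      have := Λ.sub_mem hxπ hpπ
      simpa using this
    obtain ⟨z, hz⟩ := hΛrep _ h1
    have hz0 : ∀ i, 0 ≤ z i := by
      intro i
      have h2 := congrArg (L i) hz
      rw [hLz, map_sub, hLp] at h2
      have h3 := hLpos x hxC i
      have h4 := Int.fract_lt_one (L i x0)
      have h5 : (-1 : ℝ) < z i := by linarith
      have : -1 < z i := by exact_mod_cast h5
      omega
    refine ⟨fun i => (z i).toNat, ?_⟩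
    have : ∀ i, (((z i).toNat : ℕ) : ℤ) = z i := fun i => Int.toNat_of_nonneg (hz0 i)
    simp only [φ, this, ← hz]
    abel
  have hφadd : ∀ n i, φ (n + Pi.single i 1) = φ n + liftZ (v i) := by
    intro n i
    simp [φ, add_mul, Finset.sum_add_distrib, Pi.single_apply, add_assoc]
  let U : Set (Fin (d + 1) → ℕ) := {n | φ n ∈ coneOver A}
  have hUadd : ∀ n m, n ∈ U → n + m ∈ U := by
    intro n m hn
    have : φ (n + m) = φ n + ∑ i, m i • liftZ (v i) := by
      simp [φ, -zsmul_eq_mul, -nsmul_eq_mul, -smul_eq_mul, add_smul, Finset.sum_add_distrib,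
        add_assoc]
    change φ (n + m) ∈ coneOver A
    rw [this]
    exact AddSubmonoid.add_mem _ hn (AddSubmonoid.sum_mem _ fun i _ =>
      AddSubmonoid.nsmul_mem (AddSubmonoid.closure (liftZ '' A))
        (AddSubmonoid.subset_closure ⟨v i, hvA i, rfl⟩) _)
  have hUup : ∀ n m, n ∈ U → n ≤ m → m ∈ U := by
    intro n m hn hnm
    have := hUadd n (m - n) hn
    rwa [add_tsub_cancel_of_le hnm] at this
  have hmin : ∀ k, ∀ n ∈ U, ∑ i, n i = k → ∃ m ∈ U, m ≤ n ∧ H + ∑ i, m i ≤ M := by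
    intro k
    induction k with
    | zero =>
      intro n hn hk
      refine ⟨n, hn, le_rfl, ?_⟩
      have := hM (φ n) (hφS n hn) (by
        intro i hi
        have h1 : φ n - liftZ (v i) - π ∈ Λ := by
          have h2 := hφS n hn
          rw [hS] at h2
          have := Λ.sub_mem h2.2 (hwΛ i)
          convert this using 1
          abel
        obtain ⟨m, hm⟩ := hSφ _ hi h1
        have h3 : φ (m + Pi.single i 1) = φ n := by rw [hφadd, ← hm]; abel
        have h4 := hφinj h3
        rw [← h4] at hk
        simp [Finset.sum_add_distrib] at hk)
      rw [hφlast] at this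
      exact_mod_cast this
    | succ k ih =>
      intro n hn hk
      by_cases hmn : ∀ i : Fin (d + 1), φ n - liftZ (v i) ∉ coneOver A
      · refine ⟨n, hn, le_rfl, ?_⟩
        have := hM (φ n) (hφS n hn) hmn
        rw [hφlast] at this
        exact_mod_cast this
      · push Not at hmn
        obtain ⟨i, hi⟩ := hmn
        have h1 : φ n - liftZ (v i) - π ∈ Λ := by
          have h2 := hφS n hn
          rw [hS] at h2
          have := Λ.sub_mem h2.2 (hwΛ i)
          convert this using 1
          abel
        obtain ⟨m, hm⟩ := hSφ _ hi h1
        have h3 : φ (m + Pi.single i 1) = φ n := by rw [hφadd, ← hm]; abel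
        have h4 := hφinj h3
        rw [← h4] at hk
        simp [Finset.sum_add_distrib] at hk
        obtain ⟨m', hm', hle, hb⟩ := ih m (by change φ m ∈ coneOver A; rw [← hm]; exact hi) hk
        refine ⟨m', hm', hle.trans ?_, hb⟩
        rw [← h4]
        exact le_self_add
  have hHM : H ≤ M := by
    obtain ⟨n, hn⟩ := hSφ x0 hx0C hx0π
    obtain ⟨m, _, _, hb⟩ := hmin _ n (by change φ n ∈ coneOver A; rw [← hn]; exact hx0C) rfl
    omega
  obtain ⟨Q, hQdeg, hQ⟩ := trunc_series U (M - H) (by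
    intro n
    constructor
    · intro hn
      obtain ⟨m, hm, hle, hb⟩ := hmin _ n hn rfl
      refine hUup m _ hm fun i => le_min (hle i) ?_
      have := Finset.single_le_sum (f := m) (fun i _ => Nat.zero_le _) (Finset.mem_univ i)
      change m i ≤ M - H
      omega
    · intro hn
      exact hUup _ _ hn fun i => min_le_left _ _)
  rw [Fintype.card_fin] at hQdeg hQ
  refine ⟨Polynomial.X ^ H * Q, ?_, ?_⟩
  · refine Polynomial.natDegree_mul_le.trans ?_
    rw [Polynomial.natDegree_X_pow]
    obtain ⟨D, rfl⟩ := Nat.exists_eq_add_of_le hHM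
    obtain ⟨K, rfl⟩ := Nat.exists_eq_add_of_le hH1
    have : 1 + K + D - (1 + K) = D := by omega
    rw [this] at hQdeg
    apply Nat.le_sub_of_add_le
    nlinarith [Nat.zero_le (d * K)]
  · rw [Polynomial.coe_mul, ← hQ, ← mul_assoc]
    congr 1
    rw [Polynomial.coe_pow, Polynomial.coe_X]
    ext h
    rw [PowerSeries.coeff_X_pow_mul', PowerSeries.coeff_mk]
    have himg : {x ∈ S | x (Fin.last d) = (h : ℤ)} = φ '' {n ∈ U | H + ∑ i, n i = h} := by
      ext x
      constructor
      · rintro ⟨hxS, hxh⟩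
        have hxS' := hxS
        rw [hS] at hxS'
        obtain ⟨n, rfl⟩ := hSφ x hxS'.1 hxS'.2
        refine ⟨n, ⟨hxS'.1, ?_⟩, rfl⟩
        rw [hφlast] at hxh
        exact_mod_cast hxh
      · rintro ⟨n, ⟨hn, hh⟩, rfl⟩
        refine ⟨hφS n hn, ?_⟩
        rw [hφlast]
        exact_mod_cast hh
    rw [himg, Set.ncard_image_of_injective _ hφinj]
    split_ifs with hle
    · rw [PowerSeries.coeff_mk]
      congr 3
      ext n
      refine and_congr_right fun _ => ?_
      omega
    · have : {n ∈ U | H + ∑ i, n i = h} = ∅ := by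
        ext n
        simp only [Set.mem_ofPred_eq, Set.mem_empty_iff_false, iff_false, not_and]
        intro _
        omega
      rw [this]; simp
end

section
/- Let d ≥ 1, let A ⊆ ℤ^d be finite with A − A generating ℤ^d as an additive group, and suppose v_1, …, v_{d+1} ∈ A are affinely independent over ℝ and A is contained in the convex hull of {v_1, …, v_{d+1}}. Then there exists a polynomial P ∈ ℚ[t] of degree at most (d+1)·D − 1 − 2d such that the identity (∑_{h≥0} |hA| t^h) · (1−t)^{d+1} = P(t) holds in the formal power series ring ℚ[[t]]. -/
open Pointwise

namespace ConeSeries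

/-- Pigeonhole: a long list over a small finite group has a nonempty zero-sum segment. -/
lemma exists_zero_segment {G : Type*} [AddCommGroup G] [Finite G] (K : AddSubgroup G) {X : Type*}
    (f : X → G) (l : List X) (hl : ∀ b ∈ l, f b ∈ K) (hlen : Nat.card K ≤ l.length) :
    ∃ l₁ l₂ l₃ : List X, l = l₁ ++ l₂ ++ l₃ ∧ l₂ ≠ [] ∧ (l₂.map f).sum = 0 := by
  have hmem : ∀ m : List X, (∀ b ∈ m, b ∈ l) → (m.map f).sum ∈ K := by
    intro m hm
    apply AddSubgroup.list_sum_mem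
    intro x hx
    obtain ⟨b, hb, rfl⟩ := List.mem_map.1 hx
    exact hl b (hm b hb)
  let g : Fin (l.length + 1) → K := fun i =>
    ⟨((l.take i).map f).sum, hmem _ (fun b hb => List.mem_of_mem_take hb)⟩
  have hni : ¬ Function.Injective g := by
    intro hi
    have := Nat.card_le_card_of_injective g hi
    simp at this
    omega
  have : ∃ i j : Fin (l.length + 1), i < j ∧ g i = g j := by
    unfold Function.Injective at hni
    push Not at hni
    obtain ⟨a, b, hab, hne⟩ := hni
    rcases lt_or_gt_of_ne hne with h | h
    · exact ⟨a, b, h, hab⟩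
    · exact ⟨b, a, h, hab.symm⟩
  obtain ⟨i, j, hij, hg⟩ := this
  have hij' : (i : ℕ) < j := hij
  have hj := j.2
  have hsplit : l.take j = l.take i ++ (l.take j).drop i := by
    conv_lhs => rw [← List.take_append_drop i (l.take j)]
    rw [List.take_take, min_eq_left hij'.le]
  refine ⟨l.take i, (l.take j).drop i, l.drop j, ?_, ?_, ?_⟩
  · rw [← hsplit, List.take_append_drop]
  · intro h
    have := congrArg List.length h
    simp at this
    omega
  · have h1 : ((l.take i).map f).sum = ((l.take j).map f).sum := congrArg Subtype.val hg
    rw [hsplit, List.map_append, List.sum_append] at h1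
    simpa using h1

/-- Reduction modulo `D`. -/
def red (n D : ℕ) : (Fin n → ℤ) →+ (Fin n → ZMod D) where
  toFun x i := (x i : ZMod D)
  map_zero' := by ext; simp
  map_add' x y := by ext; simp

lemma red_apply (n D : ℕ) (x : Fin n → ℤ) (i : Fin n) : red n D x i = (x i : ZMod D) := rfl

lemma reduce {n D : ℕ} (hD : 0 < D) {B : Set (Fin n → ℤ)} (hB0 : ∀ b ∈ B, ∀ i, 0 ≤ b i)
    {K : AddSubgroup (Fin n → ZMod D)} (hK : Nat.card K ≤ D) (hBK : ∀ b ∈ B, red n D b ∈ K) :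
    ∀ k : ℕ, ∀ l : List (Fin n → ℤ), l.length = k → (∀ b ∈ l, b ∈ B) →
    ∃ w : Fin n → ℕ, ∃ l' : List (Fin n → ℤ), (∀ b ∈ l', b ∈ B) ∧ l'.length < D ∧
      l.sum = (fun i => (D : ℤ) * w i) + l'.sum := by
  have : NeZero D := ⟨hD.ne'⟩
  intro k
  induction k using Nat.strong_induction_on with
  | _ k ih =>
    intro l hlk hl
    by_cases hlt : l.length < D
    · refine ⟨0, l, hl, hlt, ?_⟩
      ext i; simp
    · push Not at hlt
      obtain ⟨l₁, l₂, l₃, rfl, hne, hs⟩ := exists_zero_segment K (red n D) l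
        (fun b hb => hBK b (hl b hb)) (hK.trans hlt)
      have hlen : 0 < l₂.length := List.length_pos_of_ne_nil hne
      obtain ⟨w, l', hl', hlen', he⟩ := ih (l₁ ++ l₃).length (by simp at hlk ⊢; omega) (l₁ ++ l₃) rfl
        (fun b hb => hl b (by simp at hb ⊢; tauto))
      rw [← map_list_sum] at hs
      have hdvd : ∀ i, (D : ℤ) ∣ l₂.sum i := by
        intro i
        rw [← ZMod.intCast_zmod_eq_zero_iff_dvd]
        exact congrFun hs i
      have hnn : ∀ i, 0 ≤ l₂.sum i := by
        intro i
        have : (0 : Fin n → ℤ) ≤ l₂.sum := List.sum_nonneg (fun b hb i => hB0 b (hl b (by simp; tauto)) i)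
        exact this i
      have : ∀ i, ∃ u : ℕ, l₂.sum i = (D : ℤ) * u := by
        intro i
        obtain ⟨u, hu⟩ := hdvd i
        have h0 := hnn i
        rw [hu] at h0
        have : 0 ≤ u := nonneg_of_mul_nonneg_right h0 (by exact_mod_cast hD)
        exact ⟨u.toNat, by rw [hu, Int.toNat_of_nonneg this]⟩
      choose u hu using this
      refine ⟨w + u, l', hl', hlen', ?_⟩
      have e1 : (l₁ ++ l₂ ++ l₃).sum = l₂.sum + (l₁ ++ l₃).sum := by
        simp only [List.sum_append]; abel
      rw [e1, he]
      ext i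
      simp [hu i]
      ring

/-- the vector `D · 1_T` -/
def ev {n : ℕ} (D : ℕ) (T : Finset (Fin n)) : Fin n → ℤ := fun i => if i ∈ T then (D : ℤ) else 0

lemma exists_list {n D : ℕ} (hD : 0 < D) {B : Set (Fin n → ℤ)} (hB0 : ∀ b ∈ B, ∀ i, 0 ≤ b i)
    (hBv : ∀ i, Pi.single i (D : ℤ) ∈ B) (hBs : ∀ b ∈ B, ∑ i, b i = D)
    {K : AddSubgroup (Fin n → ZMod D)} (hK : Nat.card K ≤ D) (hBK : ∀ b ∈ B, red n D b ∈ K)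
    (s : Fin n → ℤ) (i : Fin n) (hs : s ∈ AddSubmonoid.closure B)
    (hs' : s - Pi.single i (D : ℤ) ∉ AddSubmonoid.closure B) :
    ∃ l : List (Fin n → ℤ), (∀ b ∈ l, b ∈ B ∧ b i < D) ∧ l.length < D ∧ s i = (l.map (· i)).sum := by
  obtain ⟨l₀, hl₀, rfl⟩ := AddSubmonoid.exists_list_of_mem_closure hs
  obtain ⟨w, l, hl, hlen, he⟩ := reduce hD hB0 hK hBK _ l₀ rfl hl₀
  have hw : ∀ w : Fin n → ℕ, (fun i => (D : ℤ) * w i) ∈ AddSubmonoid.closure B := by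
    intro w
    have : (fun i => (D : ℤ) * w i) = ∑ i, w i • Pi.single i (D : ℤ) := by
      ext j
      simp [Finset.sum_apply, Pi.single_apply, mul_comm]
    rw [this]
    exact AddSubmonoid.sum_mem _ (fun i _ => AddSubmonoid.nsmul_mem _ (AddSubmonoid.subset_closure (hBv i)) _)
  have hls : ∀ l : List (Fin n → ℤ), (∀ b ∈ l, b ∈ B) → l.sum ∈ AddSubmonoid.closure B := fun l hl =>
    AddSubmonoid.list_sum_mem _ (fun b hb => AddSubmonoid.subset_closure (hl b hb))
  have hwi : w i = 0 := by
    by_contra hne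
    apply hs'
    have : l₀.sum - Pi.single i (D : ℤ) = (fun j => (D : ℤ) * ((w - Pi.single i 1 : Fin n → ℕ) j : ℕ)) + l.sum := by
      rw [he]
      ext j
      by_cases hj : j = i
      · subst hj
        simp
        rw [Nat.cast_sub (by omega)]
        push_cast; ring
      · simp [hj]
    rw [this]
    exact add_mem (hw _) (hls _ hl)
  refine ⟨l, fun b hb => ⟨hl b hb, ?_⟩, hlen, ?_⟩
  · by_contra hge
    push Not at hge
    have hbB := hl b hb
    have hsum := hBs b hbB
    have hbe : b = Pi.single i (D : ℤ) := by
      rw [← Finset.add_sum_erase _ _ (Finset.mem_univ i)] at hsum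
      have h0 : ∀ j ∈ Finset.univ.erase i, 0 ≤ b j := fun j _ => hB0 b hbB j
      have h1 := Finset.sum_nonneg h0
      have h2 : ∑ j ∈ Finset.univ.erase i, b j = 0 := by omega
      rw [Finset.sum_eq_zero_iff_of_nonneg h0] at h2
      ext j
      by_cases hj : j = i
      · subst hj; simp; omega
      · simp [hj, h2 j (by simp [hj])]
    apply hs'
    have : l₀.sum - Pi.single i (D : ℤ) = (fun j => (D : ℤ) * w j) + (l.erase b).sum := by
      rw [he, ← List.sum_erase hb, hbe]; abel
    rw [this]
    exact add_mem (hw _) (hls _ (fun x hx => hl x (List.mem_of_mem_erase hx)))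
  · rw [he]
    have := map_list_sum (Pi.evalAddMonoidHom (fun _ : Fin n => ℤ) i) l
    simp only [Pi.evalAddMonoidHom_apply] at this
    simp [hwi, this]
    rfl

lemma key {d D : ℕ} (hD : 0 < D) {B : Set (Fin (d + 1) → ℤ)} (hB0 : ∀ b ∈ B, ∀ i, 0 ≤ b i)
    (hBv : ∀ i, Pi.single i (D : ℤ) ∈ B) (hBs : ∀ b ∈ B, ∑ i, b i = D)
    {K : AddSubgroup (Fin (d + 1) → ZMod D)} (hK : Nat.card K ≤ D)
    (hBK : ∀ b ∈ B, red (d + 1) D b ∈ K)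
    (s : Fin (d + 1) → ℤ)
    (hs : ∀ i, ∃ T : Finset (Fin (d + 1)), i ∉ T ∧ s - ev D T ∈ AddSubmonoid.closure B ∧
      s - ev D (insert i T) ∉ AddSubmonoid.closure B) :
    ∑ i, s i ≤ D * (((d + 1) * D - 1 - 2 * d : ℕ) : ℤ) := by
  have : NeZero D := ⟨hD.ne'⟩
  have hD' : (1 : ℤ) ≤ D := by exact_mod_cast hD
  have step : ∀ i, ∃ l : List (Fin (d + 1) → ℤ), (∀ b ∈ l, b ∈ B ∧ b i < D) ∧ l.length < D ∧
      s i = (l.map (· i)).sum := by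
    intro i
    obtain ⟨T, hiT, h1, h2⟩ := hs i
    have e : s - ev D (insert i T) = s - ev D T - Pi.single i (D : ℤ) := by
      ext j
      by_cases hj : j = i
      · subst hj; simp [ev, hiT]
      · simp [ev, hj]
    rw [e] at h2
    obtain ⟨l, a, b, c⟩ := exists_list hD hB0 hBv hBs hK hBK _ i h1 h2
    refine ⟨l, a, b, ?_⟩
    rw [← c]
    simp [ev, hiT]
  have bd : ∀ (i) (l : List (Fin (d + 1) → ℤ)) (c : ℤ), (∀ b ∈ l, b i ≤ c) →
      (l.map (· i)).sum ≤ l.length * c := by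
    intro i l c h
    have := List.sum_le_card_nsmul (l.map (· i)) c (by
      intro x hx
      obtain ⟨b, hb, rfl⟩ := List.mem_map.1 hx
      exact h b hb)
    simpa using this
  have hle : ∀ i, s i ≤ ((D : ℤ) - 1) * (D - 1) := by
    intro i
    obtain ⟨l, h1, h2, h3⟩ := step i
    rw [h3]
    refine (bd i l (D - 1) (fun b hb => by have := (h1 b hb).2; omega)).trans ?_
    apply mul_le_mul_of_nonneg_right _ (by omega)
    omega
  rcases Nat.lt_or_ge D 2 with h2 | h2
  · have : D = 1 := by omega
    subst this
    have : ∑ i, s i ≤ 0 := Finset.sum_nonpos (fun i _ => by simpa using hle i)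
    refine this.trans ?_
    positivity
  -- now `2 ≤ D`
  set M : Finset (Fin (d + 1)) := Finset.univ.filter (fun i => s i = ((D : ℤ) - 1) * (D - 1)) with hM
  have hMD : M.card ≤ D := by
    rcases M.eq_empty_or_nonempty with h | ⟨i, hi⟩
    · simp [h]
    have hsi : s i = ((D : ℤ) - 1) * (D - 1) := by simpa [hM] using hi
    obtain ⟨l, h1, hl2, h3⟩ := step i
    have : ∃ b ∈ l, b i = (D : ℤ) - 1 := by
      by_contra hcon
      push Not at hcon
      have := bd i l (D - 2) (fun b hb => by
        have := (h1 b hb).2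
        have := hcon b hb
        omega)
      rw [← h3, hsi] at this
      have h4 : (l.length : ℤ) * (D - 2) ≤ (D - 1) * (D - 2) :=
        mul_le_mul_of_nonneg_right (by omega) (by omega)
      nlinarith
    obtain ⟨b, hbl, hbi⟩ := this
    have hbB := (h1 b hbl).1
    have hsK : red (d + 1) D s ∈ K := by
      obtain ⟨T, -, hT, -⟩ := hs i
      have h5 : red (d + 1) D (s - ev D T) ∈ K := by
        have : AddSubmonoid.closure B ≤ K.toAddSubmonoid.comap (red (d + 1) D) :=
          AddSubmonoid.closure_le.2 hBK
        exact this hT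
      have h6 : red (d + 1) D (s - ev D T) = red (d + 1) D s := by
        ext j
        simp [red_apply, ev]
      rwa [h6] at h5
    have hbK := hBK b hbB
    -- evaluation at `i` is injective on `K`
    let φ : K → ZMod D := fun x => x.1 i
    have hφs : Function.Surjective φ := by
      intro z
      refine ⟨⟨z.val • (-red (d + 1) D b), K.nsmul_mem (K.neg_mem hbK) _⟩, ?_⟩
      change z.val • (-((b i : ℤ) : ZMod D)) = z
      rw [hbi]
      simp
    have hφ : Function.Injective φ := by
      have hc : Nat.card K ≤ Nat.card (ZMod D) := by simpa using hK
      exact ((Nat.bijective_iff_surjective_and_card φ).2 ⟨hφs, le_antisymm hc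
        (Nat.card_le_card_of_surjective φ hφs)⟩).1
    have hneg : red (d + 1) D s = - red (d + 1) D b := by
      have : (⟨red (d + 1) D s, hsK⟩ : K) = ⟨- red (d + 1) D b, K.neg_mem hbK⟩ := by
        apply hφ
        simp [φ, red_apply, hsi, hbi]
      exact congrArg Subtype.val this
    have hbj : ∀ j ∈ M, b j = (D : ℤ) - 1 := by
      intro j hj
      have hsj : s j = ((D : ℤ) - 1) * (D - 1) := by simpa [hM] using hj
      have h7 := congrFun hneg j
      simp only [red_apply, Pi.neg_apply, hsj] at h7
      have h8 : ((b j + 1 : ℤ) : ZMod D) = 0 := by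
        push_cast at h7 ⊢
        simp at h7
        rw [h7]; ring
      rw [ZMod.intCast_zmod_eq_zero_iff_dvd] at h8
      have h9 := hB0 b hbB j
      have h10 : b j ≤ D := by
        rw [← hBs b hbB]
        exact Finset.single_le_sum (fun k _ => hB0 b hbB k) (Finset.mem_univ j)
      obtain ⟨u, hu⟩ := h8
      have : u = 1 := by
        have hu1 : 0 < u := by
          by_contra h; push Not at h; nlinarith
        have hu2 : u < 2 := by
          by_contra h; push Not at h; nlinarith
        omega
      subst this
      omega
    have h11 : ∑ j ∈ M, b j ≤ D := by
      rw [← hBs b hbB]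
      exact Finset.sum_le_sum_of_subset_of_nonneg (Finset.subset_univ _) (fun j _ _ => hB0 b hbB j)
    rw [Finset.sum_congr rfl hbj] at h11
    simp at h11
    have : (M.card : ℤ) ≤ D := by nlinarith
    exact_mod_cast this
  have hsum : ∑ i, s i ≤ ∑ i, ((D : ℤ) * (D - 2) + if i ∈ M then 1 else 0) := by
    apply Finset.sum_le_sum
    intro i _
    have := hle i
    by_cases hi : i ∈ M
    · simp only [hi, if_true]; nlinarith
    · have hne : s i ≠ ((D : ℤ) - 1) * (D - 1) := by simpa [hM] using hi
      simp only [hi, if_false]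
      have : s i < ((D : ℤ) - 1) * (D - 1) := lt_of_le_of_ne this hne
      nlinarith
  refine hsum.trans ?_
  rw [Finset.sum_add_distrib]
  simp only [Finset.sum_const, Finset.card_univ, Fintype.card_fin, Finset.sum_ite_mem, Finset.univ_inter]
  have hcast : (((d + 1) * D - 1 - 2 * d : ℕ) : ℤ) = (d + 1) * D - 1 - 2 * d := by
    obtain ⟨e, rfl⟩ := Nat.exists_eq_add_of_le h2
    have : (d + 1) * (2 + e) - 1 - 2 * d = (d + 1) * e + 1 := by
      have : (d + 1) * (2 + e) = (d + 1) * e + 2 * d + 2 := by ring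
      omega
    rw [this]; push_cast; ring
  rw [hcast]
  have : (M.card : ℤ) ≤ D := by exact_mod_cast hMD
  simp
  nlinarith


lemma ev_sum {n : ℕ} (D : ℕ) (T : Finset (Fin n)) : ∑ i, ev D T i = D * T.card := by
  simp [ev, mul_comm]

lemma ev_insert {n : ℕ} (D : ℕ) (T : Finset (Fin n)) (i : Fin n) (hiT : i ∉ T) :
    ev D (insert i T) = ev D T + Pi.single i (D : ℤ) := by
  ext j
  by_cases hj : j = i
  · subst hj; simp [ev, hiT]
  · simp [ev, hj]

lemma cancel {n : ℕ} (p : Finset (Fin n) → Prop) [DecidablePred p] (i : Fin n)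
    (h : ∀ T, i ∉ T → (p T ↔ p (insert i T))) :
    ∑ T : Finset (Fin n), (-1 : ℚ) ^ T.card * (if p T then 1 else 0) = 0 := by
  have huniv : (Finset.univ : Finset (Finset (Fin n))) =
      (insert i (Finset.univ.erase i)).powerset := by
    rw [Finset.insert_erase (Finset.mem_univ i), Finset.powerset_univ]
  rw [huniv, Finset.sum_powerset_insert (by simp), ← Finset.sum_add_distrib]
  apply Finset.sum_eq_zero
  intro T hT
  have hiT : i ∉ T := fun hi => by simpa using (Finset.mem_powerset.1 hT) hi
  rw [Finset.card_insert_of_notMem hiT, if_congr (h T hiT) rfl rfl]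
  ring

lemma series {d D : ℕ} (hD : 0 < D) {B : Set (Fin (d + 1) → ℤ)} (hB0 : ∀ b ∈ B, ∀ i, 0 ≤ b i)
    (hBv : ∀ i, Pi.single i (D : ℤ) ∈ B) (hBs : ∀ b ∈ B, ∑ i, b i = D)
    {K : AddSubgroup (Fin (d + 1) → ZMod D)} (hK : Nat.card K ≤ D)
    (hBK : ∀ b ∈ B, red (d + 1) D b ∈ K) (a : ℕ → ℕ)
    (ha : ∀ h, a h = {s | s ∈ AddSubmonoid.closure B ∧ ∑ i, s i = D * (h : ℤ)}.ncard) :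
    ∃ P : Polynomial ℚ, P.natDegree ≤ (d + 1) * D - 1 - 2 * d ∧
      (PowerSeries.mk fun h : ℕ => (a h : ℚ)) *
        (1 - PowerSeries.X) ^ (d + 1) = (P : PowerSeries ℚ) := by
  classical
  set N := (d + 1) * D - 1 - 2 * d with hN
  set F : PowerSeries ℚ := (PowerSeries.mk fun h : ℕ => (a h : ℚ)) * (1 - PowerSeries.X) ^ (d + 1) with hF
  have hD' : (0 : ℤ) < D := by exact_mod_cast hD
  set S := AddSubmonoid.closure B with hS
  have hS0 : ∀ s ∈ S, ∀ i, 0 ≤ s i := by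
    intro s hs
    induction hs using AddSubmonoid.closure_induction with
    | mem x hx => exact hB0 x hx
    | zero => intro i; simp
    | add x y _ _ hx hy => intro i; exact add_nonneg (hx i) (hy i)
  have main : ∀ h, N < h → PowerSeries.coeff h F = 0 := by
    intro h hh
    have e1 : (1 - PowerSeries.X : PowerSeries ℚ) ^ (d + 1) =
        ∑ T : Finset (Fin (d + 1)), (-1 : PowerSeries ℚ) ^ T.card * PowerSeries.X ^ T.card := by
      have := Finset.sum_pow_mul_eq_add_pow (-PowerSeries.X : PowerSeries ℚ) 1
        (Finset.univ : Finset (Fin (d + 1)))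
      simp only [Finset.powerset_univ, one_pow, mul_one, Finset.card_univ, Fintype.card_fin] at this
      rw [sub_eq_neg_add, ← this]
      exact Finset.sum_congr rfl (fun T _ => by rw [neg_pow])
    let Bx : Finset (Fin (d + 1) → ℤ) := (Finset.Icc 0 (fun _ => (D * h : ℤ))).filter
      (fun s => ∑ i, s i = D * (h : ℤ))
    have e2 : ∀ T : Finset (Fin (d + 1)),
        PowerSeries.coeff h ((PowerSeries.mk fun h : ℕ => (a h : ℚ)) *
          ((-1 : PowerSeries ℚ) ^ T.card * PowerSeries.X ^ T.card)) =
        (-1) ^ T.card * ∑ s ∈ Bx, (if s - ev D T ∈ S then (1 : ℚ) else 0) := by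
      intro T
      have e3 : (PowerSeries.mk fun h : ℕ => (a h : ℚ)) *
          ((-1 : PowerSeries ℚ) ^ T.card * PowerSeries.X ^ T.card) =
          PowerSeries.C ((-1 : ℚ) ^ T.card) *
            ((PowerSeries.mk fun h : ℕ => (a h : ℚ)) * PowerSeries.X ^ T.card) := by
        simp only [map_pow, map_neg, map_one]; ring
      rw [e3, PowerSeries.coeff_C_mul, PowerSeries.coeff_mul_X_pow']
      congr 1
      rw [Finset.sum_boole]
      split_ifs with hT
      · rw [PowerSeries.coeff_mk, ha]
        congr 1
        rw [← Set.ncard_coe_finset (Finset.filter _ Bx), ← Set.ncard_image_of_injective _ (add_left_injective (ev D T))]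
        apply congrArg
        ext s
        simp only [Set.mem_image, Set.mem_ofPred_eq, Finset.coe_filter, Bx, Finset.mem_filter,
          Finset.mem_Icc]
        constructor
        · rintro ⟨s, ⟨hs, hsum⟩, rfl⟩
          have h0 : ∀ i, 0 ≤ (s + ev D T) i := by
            intro i
            have := hS0 s hs i
            simp only [Pi.add_apply, ev]
            split_ifs <;> omega
          have hsum' : ∑ i, (s + ev D T) i = D * (h : ℤ) := by
            simp only [Pi.add_apply, Finset.sum_add_distrib, ev_sum, hsum]
            push_cast [hT]; ring
          refine ⟨⟨⟨fun i => h0 i, fun i => ?_⟩, hsum'⟩, by simpa using hs⟩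
          simp only
          rw [← hsum']
          exact Finset.single_le_sum (fun k _ => h0 k) (Finset.mem_univ i)
        · rintro ⟨⟨-, hsum⟩, hs⟩
          refine ⟨s - ev D T, ⟨hs, ?_⟩, by simp⟩
          simp only [Pi.sub_apply, Finset.sum_sub_distrib, ev_sum, hsum]
          push_cast [hT]; ring
      · symm
        rw [Nat.cast_eq_zero, Finset.card_eq_zero, Finset.filter_eq_empty_iff]
        intro s hs hs'
        have hsum : ∑ i, s i = D * (h : ℤ) := (Finset.mem_filter.1 hs).2
        have h0 : 0 ≤ ∑ i, (s - ev D T) i := Finset.sum_nonneg (fun i _ => hS0 _ hs' i)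
        simp only [Pi.sub_apply, Finset.sum_sub_distrib, ev_sum, hsum] at h0
        push Not at hT
        have : (h : ℤ) < T.card := by exact_mod_cast hT
        nlinarith
    rw [hF, e1, Finset.mul_sum, map_sum, Finset.sum_congr rfl (fun T _ => e2 T)]
    simp only [Finset.mul_sum]
    rw [Finset.sum_comm]
    apply Finset.sum_eq_zero
    intro s hs
    have hsum : ∑ i, s i = D * (h : ℤ) := (Finset.mem_filter.1 hs).2
    by_cases hall : ∀ i, ∃ T : Finset (Fin (d + 1)), i ∉ T ∧ s - ev D T ∈ S ∧
      s - ev D (insert i T) ∉ S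
    · exfalso
      have := key hD hB0 hBv hBs hK hBK s hall
      rw [hsum, ← hN] at this
      have h3 : (h : ℤ) ≤ N := le_of_mul_le_mul_left this hD'
      omega
    · push Not at hall
      obtain ⟨i, hi⟩ := hall
      refine cancel (fun T => s - ev D T ∈ S) i (fun T hiT => ⟨hi T hiT, fun hmem => ?_⟩)
      have : s - ev D T = (s - ev D (insert i T)) + Pi.single i (D : ℤ) := by
        rw [ev_insert D T i hiT]; abel
      rw [this]
      exact add_mem hmem (AddSubmonoid.subset_closure (hBv i))
  refine ⟨F.trunc (N + 1), ?_, ?_⟩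
  · exact Nat.lt_succ_iff.1 (PowerSeries.natDegree_trunc_lt F N)
  · ext h
    rw [Polynomial.coeff_coe, PowerSeries.coeff_trunc]
    split_ifs with hlt
    · rfl
    · exact main h (by omega)

lemma mem_iterSumset {n D : ℕ} (hD : 0 < D) {B : Set (Fin n → ℤ)}
    (hBs : ∀ b ∈ B, ∑ i, b i = D) (h : ℕ) (s : Fin n → ℤ) :
    s ∈ iterSumset B h ↔ s ∈ AddSubmonoid.closure B ∧ ∑ i, s i = D * (h : ℤ) := by
  have fwd : ∀ h s, s ∈ iterSumset B h → s ∈ AddSubmonoid.closure B ∧ ∑ i, s i = D * (h : ℤ) := by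
    intro h
    induction h with
    | zero => rintro s rfl; simp
    | succ h ih =>
      rintro s ⟨b, hb, t, ht, rfl⟩
      obtain ⟨h1, h2⟩ := ih t ht
      refine ⟨add_mem (AddSubmonoid.subset_closure hb) h1, ?_⟩
      simp only [Pi.add_apply, Finset.sum_add_distrib, h2, hBs b hb]
      push_cast; ring
  refine ⟨fwd h s, ?_⟩
  rintro ⟨hs, hsum⟩
  obtain ⟨l, hl, rfl⟩ := AddSubmonoid.exists_list_of_mem_closure hs
  have : ∀ l : List (Fin n → ℤ), (∀ b ∈ l, b ∈ B) → l.sum ∈ iterSumset B l.length := by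
    intro l
    induction l with
    | nil => intro _; simp [iterSumset]
    | cons x l ih =>
      intro hl
      exact Set.add_mem_add (hl x (by simp)) (ih (fun b hb => hl b (by simp [hb])))
  have h1 := this l hl
  have h2 := (fwd _ _ h1).2
  rw [hsum] at h2
  have h3 := mul_left_cancel₀ (by exact_mod_cast hD.ne') h2
  have h4 : h = l.length := by exact_mod_cast h3
  rwa [h4]


lemma card_range {n D : ℕ} (hD : 0 < D) (M : Matrix (Fin n) (Fin n) ℤ)
    (hdet : (D : ℤ) = |M.det|) (c : (Fin n → ℤ) →+ (Fin n → ℤ))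
    (hc : ∀ x, M.mulVec (c x) = (D : ℤ) • x) :
    Nat.card ((red n D).comp c).range ≤ D := by
  have hD0 : (D : ℤ) ≠ 0 := by exact_mod_cast hD.ne'
  have hdet0 : M.det ≠ 0 := by
    intro h; rw [h] at hdet; simp at hdet; omega
  rw [← AddSubgroup.index_ker]
  let f : (Fin n → ℤ) →ₗ[ℤ] (Fin n → ℤ) := Matrix.toLin' M
  have hinj : Function.Injective f := by
    rw [injective_iff_map_eq_zero]
    intro x hx
    exact Matrix.eq_zero_of_mulVec_eq_zero hdet0 (by simpa [f] using hx)
  let e := LinearEquiv.ofInjective f hinj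
  have h1 := Submodule.natAbs_det_equiv (LinearMap.range f) e
  have h2 : (LinearMap.range f).subtype ∘ₗ AddMonoidHom.toIntLinearMap
      ((e : (Fin n → ℤ) →+ LinearMap.range f)) = f := by
    ext; rfl
  rw [h2] at h1
  have h3 : LinearMap.det f = M.det := LinearMap.det_toLin' M
  rw [h3] at h1
  have h4 : ((LinearMap.range f).toAddSubgroup).index = D := by
    have : ((LinearMap.range f).toAddSubgroup).index = Nat.card ((Fin n → ℤ) ⧸ LinearMap.range f) := rfl
    rw [this, ← h1]
    have := Int.natCast_natAbs M.det
    omega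
  have hle : (LinearMap.range f).toAddSubgroup = ((red n D).comp c).ker := by
    have hfwd : ((red n D).comp c).ker ≤ (LinearMap.range f).toAddSubgroup := by
      intro x hx
      have hx' : red n D (c x) = 0 := hx
      have : ∀ i, ∃ y : ℤ, c x i = D * y := by
        intro i
        have := congrFun hx' i
        rw [red_apply, Pi.zero_apply, ZMod.intCast_zmod_eq_zero_iff_dvd] at this
        exact this
      choose y hy using this
      refine ⟨y, ?_⟩
      have h5 : c x = (D : ℤ) • y := by ext i; simp [hy i]
      have h6 := hc x
      rw [h5, Matrix.mulVec_smul] at h6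
      have := smul_right_injective _ hD0 h6
      simpa [f] using this
    refine le_antisymm ?_ hfwd
    rintro _ ⟨y, rfl⟩
    change red n D (c (f y)) = 0
    have h6 := hc (f y)
    have h7 : c (f y) = (D : ℤ) • y := by
      have : M.mulVec (c (f y)) = M.mulVec ((D : ℤ) • y) := by
        rw [h6, Matrix.mulVec_smul]; simp [f]
      exact hinj (by simpa [f] using this)
    rw [h7]
    ext i
    simp [red_apply]
  rw [← hle, h4]

lemma snoc_add {d : ℕ} {R : Type*} [Add R] (x y : Fin d → R) (a b : R) :
    (Fin.snoc (x + y) (a + b) : Fin (d + 1) → R) = (Fin.snoc x a : Fin (d + 1) → R) + (Fin.snoc y b : Fin (d + 1) → R) := by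
  ext i
  refine Fin.lastCases ?_ (fun i => ?_) i <;> simp

lemma snoc_mul {d : ℕ} {R : Type*} [Mul R] (r : R) (x : Fin d → R) (a : R) (i : Fin (d + 1)) :
    (Fin.snoc (fun i => r * x i) (r * a) : Fin (d + 1) → R) i = r * (Fin.snoc x a : Fin (d + 1) → R) i := by
  refine Fin.lastCases ?_ (fun i => ?_) i <;> simp

lemma image_iterSumset {d : ℕ} (A : Set (Fin d → ℤ)) (c : (Fin (d + 1) → ℤ) →+ (Fin (d + 1) → ℤ))
    (h : ℕ) : Set.image (fun x : Fin d → ℤ => c (Fin.snoc x (h : ℤ))) (iterSumset A h) =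
      iterSumset (Set.image (fun x => c (liftZ x)) A) h := by
  induction h with
  | zero =>
    have : (Fin.snoc (0 : Fin d → ℤ) (0 : ℤ) : Fin (d + 1) → ℤ) = 0 := by
      ext i
      refine Fin.lastCases ?_ (fun i => ?_) i <;> simp
    simp [iterSumset, this]
  | succ h ih =>
    simp only [iterSumset]
    rw [← ih]
    have e : ∀ x y : Fin d → ℤ, c (Fin.snoc (x + y) ((h + 1 : ℕ) : ℤ)) =
        c (liftZ x) + c (Fin.snoc y (h : ℤ)) := by
      intro x y
      rw [← map_add, liftZ, ← snoc_add]
      congr 2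
      push_cast; ring
    ext s
    constructor
    · rintro ⟨_, ⟨x, hx, y, hy, rfl⟩, rfl⟩
      exact ⟨_, ⟨x, hx, rfl⟩, _, ⟨y, hy, rfl⟩, (e x y).symm⟩
    · rintro ⟨_, ⟨x, hx, rfl⟩, _, ⟨y, hy, rfl⟩, rfl⟩
      exact ⟨x + y, ⟨x, hx, y, hy, rfl⟩, e x y⟩

lemma det_ne_zero {d : ℕ} (v : Fin (d + 1) → Fin d → ℤ)
    (haff : AffineIndependent ℝ (fun i (j : Fin d) => (v i j : ℝ))) :
    (Matrix.of fun r c => liftZ (v c) r).det ≠ 0 := by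
  intro h0
  have h1 : ((Matrix.of fun r c => liftZ (v c) r).map (Int.castRingHom ℝ)).det = 0 := by
    rw [← RingHom.mapMatrix_apply, ← RingHom.map_det, h0, map_zero]
  obtain ⟨w, hw, hMw⟩ := Matrix.exists_mulVec_eq_zero_iff.2 h1
  apply hw
  have hr : ∀ r, ∑ i, (liftZ (v i) r : ℝ) * w i = 0 := by
    intro r
    have := congrFun hMw r
    simpa [Matrix.mulVec, dotProduct] using this
  have hlast := hr (Fin.last d)
  simp [liftZ] at hlast
  have := affineIndependent_iff.1 haff Finset.univ w hlast (by
    ext j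
    have := hr j.castSucc
    simp [liftZ] at this
    simp only [Finset.sum_apply, Pi.smul_apply, smul_eq_mul, Pi.zero_apply]
    rw [← this]
    exact Finset.sum_congr rfl (fun i _ => mul_comm _ _))
  ext i
  exact this i (Finset.mem_univ i)

lemma coord_nonneg {d : ℕ} (v : Fin (d + 1) → Fin d → ℤ) (N : Matrix (Fin (d + 1)) (Fin (d + 1)) ℤ)
    (hN : ∀ i j, 0 ≤ N.mulVec (liftZ (v i)) j) (a : Fin d → ℤ)
    (ha : (fun j => (a j : ℝ)) ∈ convexHull ℝ (Set.range (fun i (j : Fin d) => (v i j : ℝ))))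
    (j : Fin (d + 1)) : 0 ≤ N.mulVec (liftZ a) j := by
  let L : (Fin d → ℝ) → ℝ := fun x => ∑ r, (N j r : ℝ) * (Fin.snoc x 1 : Fin (d + 1) → ℝ) r
  have hL : ∀ x : Fin d → ℤ, L (fun j => (x j : ℝ)) = ((N.mulVec (liftZ x) j : ℤ) : ℝ) := by
    intro x
    simp only [L, Matrix.mulVec, dotProduct, Int.cast_sum, Int.cast_mul]
    refine Finset.sum_congr rfl (fun r _ => ?_)
    congr 1
    refine Fin.lastCases ?_ (fun i => ?_) r <;> simp [liftZ]
  have hsub : convexHull ℝ (Set.range (fun i (j : Fin d) => (v i j : ℝ))) ⊆ {x | 0 ≤ L x} := by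
    apply convexHull_min
    · rintro _ ⟨i, rfl⟩
      simp only [Set.mem_ofPred_eq, hL]
      exact_mod_cast hN i j
    · intro x hx y hy p q hp hq hpq
      have : L (p • x + q • y) = p * L x + q * L y := by
        simp only [L, Finset.mul_sum, ← Finset.sum_add_distrib]
        refine Finset.sum_congr rfl (fun r _ => ?_)
        refine Fin.lastCases ?_ (fun i => ?_) r
        · simp only [Fin.snoc_last]
          linear_combination (-(N j (Fin.last d) : ℝ)) * hpq
        · simp; ring
      simp only [Set.mem_ofPred_eq] at hx hy ⊢
      rw [this]
      positivity
  have := hsub ha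
  simp only [Set.mem_ofPred_eq, hL] at this
  exact_mod_cast this

end ConeSeries

theorem cone_generating_series_simplex (d : ℕ) (hd : 1 ≤ d) (A : Set (Fin d → ℤ))
    (hfin : A.Finite)
    (hgen : AddSubgroup.closure (A - A) = ⊤)
    (v : Fin (d + 1) → Fin d → ℤ) (hvA : ∀ i, v i ∈ A)
    (haff : AffineIndependent ℝ (fun i (j : Fin d) => (v i j : ℝ)))
    (hhull : ∀ a ∈ A, (fun j => (a j : ℝ)) ∈
      convexHull ℝ (Set.range (fun i (j : Fin d) => (v i j : ℝ))))
    (D : ℕ) (hD : (D : ℤ) = |(Matrix.of fun r c => liftZ (v c) r).det|) :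
    ∃ P : Polynomial ℚ, P.natDegree ≤ (d + 1) * D - 1 - 2 * d ∧
      (PowerSeries.mk fun h : ℕ => ((iterSumset A h).ncard : ℚ)) *
        (1 - PowerSeries.X) ^ (d + 1) = (P : PowerSeries ℚ) := by
  have hdet := ConeSeries.det_ne_zero v haff
  set M : Matrix (Fin (d + 1)) (Fin (d + 1)) ℤ := Matrix.of fun r c => liftZ (v c) r with hM
  have hD1 : (0 : ℤ) < D := by rw [hD]; exact abs_pos.2 hdet
  have hD0 : 0 < D := by exact_mod_cast hD1
  let N : Matrix (Fin (d + 1)) (Fin (d + 1)) ℤ := M.det.sign • M.adjugate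
  have hsg : M.det.sign * M.det = D := by rw [hD, Int.sign_mul_self_eq_abs]
  have hMN : M * N = (D : ℤ) • 1 := by
    simp only [N, Matrix.mul_smul, Matrix.mul_adjugate, smul_smul, hsg]
  have hNM : N * M = (D : ℤ) • 1 := by
    simp only [N, Matrix.smul_mul, Matrix.adjugate_mul, smul_smul, hsg]
  let c : (Fin (d + 1) → ℤ) →+ (Fin (d + 1) → ℤ) := (Matrix.toLin' N).toAddMonoidHom
  have hcN : ∀ x, c x = N.mulVec x := fun x => by simp [c]
  have hc : ∀ x, M.mulVec (c x) = (D : ℤ) • x := by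
    intro x
    rw [hcN, Matrix.mulVec_mulVec, hMN, Matrix.smul_mulVec, Matrix.one_mulVec]
  have hcinj : Function.Injective c := by
    intro x y hxy
    have h1 := hc x
    rw [hxy, hc y] at h1
    exact (smul_right_injective _ hD1.ne' h1).symm
  have hcv : ∀ i, c (liftZ (v i)) = Pi.single i (D : ℤ) := by
    intro i
    have h1 : liftZ (v i) = M.mulVec (Pi.single i 1) := by
      ext r; simp [hM]
    rw [hcN, h1, Matrix.mulVec_mulVec, hNM, Matrix.smul_mulVec, Matrix.one_mulVec]
    ext j
    by_cases hj : j = i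
    · subst hj; simp
    · simp [hj]
  have hcs : ∀ x, ∑ i, c x i = D * x (Fin.last d) := by
    intro x
    have h1 := congrFun (hc x) (Fin.last d)
    simpa [Matrix.mulVec, dotProduct, hM, liftZ] using h1
  refine ConeSeries.series (B := Set.image (fun x => c (liftZ x)) A)
    (K := ((ConeSeries.red (d + 1) D).comp c).range) hD0 ?_ ?_ ?_
    (ConeSeries.card_range hD0 M hD c hc) ?_ (fun h => (iterSumset A h).ncard) ?_
  · rintro _ ⟨a, ha, rfl⟩ i
    simp only [hcN]
    refine ConeSeries.coord_nonneg v N (fun i j => ?_) a (hhull a ha) i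
    rw [← hcN, hcv, Pi.single_apply]
    split_ifs <;> omega
  · intro i
    exact ⟨v i, hvA i, hcv i⟩
  · rintro _ ⟨a, ha, rfl⟩
    simp [hcs, liftZ]
  · rintro _ ⟨a, ha, rfl⟩
    exact ⟨liftZ a, rfl⟩
  · intro h
    have hinj : Function.Injective (fun x : Fin d → ℤ => c (Fin.snoc x (h : ℤ))) := by
      intro x y hxy
      have h1 := hcinj hxy
      ext i
      simpa using congrFun h1 i.castSucc
    rw [← Set.ncard_image_of_injective _ hinj, ConeSeries.image_iterSumset]
    congr 1
    ext s
    refine ConeSeries.mem_iterSumset hD0 ?_ h s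
    rintro _ ⟨a, ha, rfl⟩
    simp [hcs, liftZ]
end
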